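/- arXiv:0806.1160 — 15 statements merged into one kernel-verified Lean document; each statement's English description precedes it below -/
import Mathlib

section
/- Let f : ℝ^d → ℝ^d be a map, let u be a fixed point of f, and suppose f is semidifferentiable at u with semidifferential g (i.e. g : ℝ^d → ℝ^d is continuous, positively homogeneous, and f(u+h) = f(u) + g(h) + o(‖h‖) as h → 0). If the only vector h in the nonpositive orthant ℝ^d_- with g(h) = h is h = 0, then u is a locally minimal fixed point of f: there is a neighborhood V of u such that every fixed point v of f in V with v ≤ u satisfies v = u. -/
/-- Let `f : ℝ^d → ℝ^d`, let `u` be a fixed point of `f`, and suppose `f`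
is semidifferentiable at `u` with semidifferential `g` (i.e. `g` is continuous, positively
homogeneous, and `f(u+h) = f(u) + g(h) + o(‖h‖)` as `h → 0`, with respect to the sup-norm
on `ℝ^d = Fin d → ℝ`). If the only `h` in the nonpositive orthant with `g h = h` is `h = 0`,
then `u` is a locally minimal fixed point of `f`. -/
theorem locally_minimal_of_no_nonzero_nonpositive_fixed_point_of_semidifferential
    {d : ℕ} (f : (Fin d → ℝ) → (Fin d → ℝ)) (u : Fin d → ℝ)
    (hu : f u = u)
    (g : (Fin d → ℝ) → (Fin d → ℝ))
    (hg_cont : Continuous g)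
    (hg_hom : ∀ t : ℝ, 0 < t → ∀ x : Fin d → ℝ, g (t • x) = t • g x)
    (hg_diff : (fun h => f (u + h) - f u - g h)
      =o[nhds (0 : Fin d → ℝ)] fun h => ‖h‖)
    (hfix : ∀ h : Fin d → ℝ, h ≤ 0 → g h = h → h = 0) :
    ∃ V ∈ nhds u, ∀ v ∈ V, f v = v → v ≤ u → v = u := by
  have hK : IsCompact (Metric.sphere (0 : Fin d → ℝ) 1 ∩ Set.Iic 0) :=
    (isCompact_sphere _ _).inter_right isClosed_Iic
  obtain ⟨c, hc, hcK⟩ := hK.exists_forall_le' (f := fun x => ‖x - g x‖) (a := 0)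
    (by fun_prop) (by
      rintro x ⟨hx, hx0⟩
      refine norm_pos_iff.2 fun h => ?_
      have hx' := hfix x hx0 (sub_eq_zero.1 h).symm
      simp [hx'] at hx)
  have hT : Filter.Tendsto (fun v => v - u) (nhds u) (nhds 0) := by
    have : Continuous fun v : Fin d → ℝ => v - u := by fun_prop
    simpa using this.tendsto u
  refine ⟨_, hT.eventually (hg_diff.def (half_pos hc)), fun v hv hfv hvu => ?_⟩
  by_contra hne
  have hpos : 0 < ‖v - u‖ := norm_pos_iff.2 (sub_ne_zero.2 hne)
  simp only [Set.mem_ofPred_eq, add_sub_cancel, hfv, hu, norm_norm] at hv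
  have hmem : ‖v - u‖⁻¹ • (v - u) ∈ Metric.sphere (0 : Fin d → ℝ) 1 ∩ Set.Iic 0 := by
    refine ⟨?_, ?_⟩
    · simp [norm_smul, hpos.ne']
    · exact smul_nonpos_of_nonneg_of_nonpos (inv_nonneg.2 hpos.le) (sub_nonpos.2 hvu)
  have hle := hcK _ hmem
  simp only [hg_hom _ (inv_pos.2 hpos), ← smul_sub, norm_smul, norm_inv, norm_norm] at hle
  rw [inv_mul_eq_div, le_div_iff₀ hpos] at hle
  nlinarith
end

section
/- Let f : ℝ^d → ℝ^d be a map, let u be a fixed point of f, and suppose f is semidifferentiable at u with semidifferential g (i.e. g : ℝ^d → ℝ^d is continuous, positively homogeneous, and f(u+h) = f(u) + g(h) + o(‖h‖) as h → 0). If the spectral radius ρ_{ℝ^d_-}(g) = sup{λ ≥ 0 : there exists x ∈ ℝ^d_- with x ≠ 0 and g(x) = λx} is strictly less than 1, then u is a locally minimal fixed point of f: there is a neighborhood V of u such that every fixed point v of f in V with v ≤ u satisfies v = u. -/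
/-- If the eigenvalues `l ≥ 0` of a continuous positively homogeneous map `g` with nonzero
eigenvectors in the nonpositive orthant have supremum less than `1`, then `g` has no nonzero
fixed point in that orthant. -/
theorem ne_self_of_sSup_eigenvalues_lt_one {d : ℕ} {g : (Fin d → ℝ) → (Fin d → ℝ)}
    (hg_cont : Continuous g)
    (hg_hom : ∀ t : ℝ, 0 < t → ∀ x : Fin d → ℝ, g (t • x) = t • g x)
    (hρ : sSup {l : ℝ | 0 ≤ l ∧ ∃ x : Fin d → ℝ, x ≤ 0 ∧ x ≠ 0 ∧ g x = l • x} < 1)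
    {x : Fin d → ℝ} (hx : x ≤ 0) (hx0 : x ≠ 0) : g x ≠ x := by
  intro hgx
  obtain ⟨C, hC⟩ := (isCompact_sphere (0 : Fin d → ℝ) 1).exists_bound_of_continuousOn
    hg_cont.continuousOn
  have hbdd : BddAbove {l : ℝ | 0 ≤ l ∧ ∃ x : Fin d → ℝ, x ≤ 0 ∧ x ≠ 0 ∧ g x = l • x} := by
    refine ⟨C, ?_⟩
    rintro l ⟨hl, y, -, hy0, hgy⟩
    have hy : ‖‖y‖⁻¹ • y‖ = 1 := norm_smul_inv_norm (𝕜 := ℝ) hy0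
    have h := hC (‖y‖⁻¹ • y) (by simpa using hy)
    rwa [hg_hom _ (inv_pos.2 (norm_pos_iff.2 hy0)), hgy, smul_comm, norm_smul, hy, mul_one,
      Real.norm_of_nonneg hl] at h
  exact hρ.not_ge (le_csSup hbdd ⟨zero_le_one, x, hx, hx0, by rw [hgx, one_smul]⟩)

/-- A continuous positively homogeneous map without nonzero fixed points in the nonpositive
orthant displaces every vector of that orthant by a fixed proportion of its norm. -/
theorem exists_mul_norm_le_norm_sub_self {d : ℕ} {g : (Fin d → ℝ) → (Fin d → ℝ)}
    (hg_cont : Continuous g)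
    (hg_hom : ∀ t : ℝ, 0 < t → ∀ x : Fin d → ℝ, g (t • x) = t • g x)
    (hg_ne : ∀ x : Fin d → ℝ, x ≤ 0 → x ≠ 0 → g x ≠ x) :
    ∃ m : ℝ, 0 < m ∧ ∀ x : Fin d → ℝ, x ≤ 0 → x ≠ 0 → m * ‖x‖ ≤ ‖g x - x‖ := by
  obtain ⟨m, hm, hmin⟩ := ((isCompact_sphere (0 : Fin d → ℝ) 1).inter_right
    (isClosed_Iic (a := (0 : Fin d → ℝ)))).exists_forall_le' (f := fun x => ‖g x - x‖) (a := 0)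
    (by fun_prop) fun x hx => norm_pos_iff.2 <| sub_ne_zero.2 <|
      hg_ne x hx.2 (ne_zero_of_mem_unit_sphere ⟨x, hx.1⟩)
  refine ⟨m, hm, fun x hx hx0 => ?_⟩
  have hpos : 0 < ‖x‖ := norm_pos_iff.2 hx0
  have hunit : ‖‖x‖⁻¹ • x‖ = 1 := norm_smul_inv_norm (𝕜 := ℝ) hx0
  have h := hmin (‖x‖⁻¹ • x)
    ⟨by simpa using hunit, smul_nonpos_of_nonneg_of_nonpos (inv_pos.2 hpos).le hx⟩
  rwa [hg_hom _ (inv_pos.2 hpos), ← smul_sub, norm_smul, norm_inv, norm_norm,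
    ← div_eq_inv_mul, le_div_iff₀ hpos] at h

/-- Let `f : ℝ^d → ℝ^d`, let `u` be a fixed point of `f`, and suppose `f`
is semidifferentiable at `u` with semidifferential `g`. If the spectral radius
`ρ_{ℝ^d_-}(g) = sup {λ ≥ 0 : ∃ x ∈ ℝ^d_- \ {0}, g x = λ x}` is strictly less than `1`,
then `u` is a locally minimal fixed point of `f`. -/
theorem locally_minimal_of_spectral_radius_of_semidifferential_lt_one
    {d : ℕ} (f : (Fin d → ℝ) → (Fin d → ℝ)) (u : Fin d → ℝ)
    (hu : f u = u)
    (g : (Fin d → ℝ) → (Fin d → ℝ))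
    (hg_cont : Continuous g)
    (hg_hom : ∀ t : ℝ, 0 < t → ∀ x : Fin d → ℝ, g (t • x) = t • g x)
    (hg_diff : (fun h => f (u + h) - f u - g h)
      =o[nhds (0 : Fin d → ℝ)] fun h => ‖h‖)
    (hρ : sSup {l : ℝ | 0 ≤ l ∧ ∃ x : Fin d → ℝ, x ≤ 0 ∧ x ≠ 0 ∧ g x = l • x} < 1) :
    ∃ V ∈ nhds u, ∀ v ∈ V, f v = v → v ≤ u → v = u := by
  obtain ⟨m, hm, hmin⟩ := exists_mul_norm_le_norm_sub_self hg_cont hg_hom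
    fun x => ne_self_of_sSup_eigenvalues_lt_one hg_cont hg_hom hρ
  have hnear := hg_diff.def (half_pos hm)
  have htendsto : Filter.Tendsto (fun v => v - u) (nhds u) (nhds 0) :=
    tendsto_sub_nhds_zero_iff.2 Filter.tendsto_id
  refine ⟨_, htendsto.eventually hnear, fun v hv hfv hvu => ?_⟩
  by_contra hne
  have hne' : v - u ≠ 0 := sub_ne_zero.2 hne
  have hle : ‖g (v - u) - (v - u)‖ ≤ m / 2 * ‖v - u‖ := by
    simpa [hfv, hu, norm_sub_rev] using hv
  have hge := hmin (v - u) (sub_nonpos.2 hvu) hne'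
  nlinarith [mul_pos hm (norm_pos_iff.2 hne')]
end

section
/- Let f : ℝ^d → ℝ^d be piecewise affine, with f_j(x) = min_{a ∈ A_j} max_{b ∈ B_a} (⟨c_{a,b}, x⟩ + r_{a,b}) for finite nonempty index sets A_j and B_a, vectors c_{a,b} ∈ ℝ^d and scalars r_{a,b}. Then for every u ∈ ℝ^d, f is semidifferentiable at u, and its semidifferential at u is the map D : ℝ^d → ℝ^d given coordinatewise by D_j(h) = min_{a ∈ Ā_j} max_{b ∈ B̄_a} ⟨c_{a,b}, h⟩, where Ā_j = {a ∈ A_j : f_j(u) = max_{b ∈ B_a} (⟨c_{a,b}, u⟩ + r_{a,b})} and B̄_a = {b ∈ B_a : ⟨c_{a,b}, u⟩ + r_{a,b} = max_{b' ∈ B_a} (⟨c_{a,b'}, u⟩ + r_{a,b'})}. -/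
open Filter Topology Set

section FiniteSup

variable {X β L : Type*} [ConditionallyCompleteLinearOrder L]

theorem Set.Finite.nonempty_argmax {S : Set β} (hS : S.Finite) (hne : S.Nonempty) (φ : β → L) :
    {b ∈ S | φ b = sSup (φ '' S)}.Nonempty := by
  obtain ⟨b, hb, h⟩ := (hne.image φ).csSup_mem (hS.image φ)
  exact ⟨b, hb, h⟩

theorem Set.Finite.nonempty_argmin {S : Set β} (hS : S.Finite) (hne : S.Nonempty) (φ : β → L) :
    {b ∈ S | φ b = sInf (φ '' S)}.Nonempty :=
  Set.Finite.nonempty_argmax (L := Lᵒᵈ) hS hne φ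

variable [TopologicalSpace X] [TopologicalSpace L] [OrderTopology L]

theorem Set.Finite.continuous_sSup_image {S : Set β} (hS : S.Finite) (hne : S.Nonempty)
    {φ : β → X → L} (hφ : ∀ b, Continuous (φ b)) :
    Continuous fun x => sSup ((fun b => φ b x) '' S) := by
  obtain ⟨s, rfl⟩ := hS.exists_finset_coe
  have hs : s.Nonempty := by simpa using hne
  simp only [← Finset.sup'_eq_csSup_image s hs]
  exact Continuous.finset_sup'_apply hs fun b _ => hφ b

theorem Set.Finite.continuous_sInf_image {S : Set β} (hS : S.Finite) (hne : S.Nonempty)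
    {φ : β → X → L} (hφ : ∀ b, Continuous (φ b)) :
    Continuous fun x => sInf ((fun b => φ b x) '' S) :=
  Set.Finite.continuous_sSup_image (L := Lᵒᵈ) hS hne hφ

/-- Near a point, a finite maximum of continuous functions is attained among the functions that
attain it at that point. -/
theorem Set.Finite.eventually_sSup_image_eq_argmax {S : Set β} (hS : S.Finite) (hne : S.Nonempty)
    {φ : β → X → L} (hφ : ∀ b, Continuous (φ b)) (x₀ : X) :
    ∀ᶠ x in 𝓝 x₀, sSup ((fun b => φ b x) '' S) =
      sSup ((fun b => φ b x) '' {b ∈ S | φ b x₀ = sSup ((fun b => φ b x₀) '' S)}) := by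
  obtain ⟨m, hm⟩ := hS.nonempty_argmax hne (fun b => φ b x₀)
  have key : ∀ᶠ x in 𝓝 x₀, ∀ b ∈ S,
      φ b x₀ ≠ sSup ((fun b => φ b x₀) '' S) → φ b x < φ m x := by
    rw [hS.eventually_all]
    intro b hb
    by_cases h : φ b x₀ = sSup ((fun b => φ b x₀) '' S)
    · exact .of_forall fun x h' => absurd h h'
    · have hle := le_csSup (hS.image (fun b => φ b x₀)).bddAbove (mem_image_of_mem _ hb)
      have hlt : φ b x₀ < φ m x₀ := lt_of_lt_of_eq (lt_of_le_of_ne hle h) hm.2.symm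
      filter_upwards [(hφ b).continuousAt.eventually_lt (hφ m).continuousAt hlt] with x hx _
      exact hx
  filter_upwards [key] with x hx
  have hsub : {b ∈ S | φ b x₀ = sSup ((fun b => φ b x₀) '' S)} ⊆ S := sep_subset _ _
  have hbdd := ((hS.subset hsub).image (fun b => φ b x)).bddAbove
  apply le_antisymm
  · apply csSup_le (hne.image _)
    rintro _ ⟨b, hb, rfl⟩
    by_cases h : φ b x₀ = sSup ((fun b => φ b x₀) '' S)
    · exact le_csSup hbdd ⟨b, ⟨hb, h⟩, rfl⟩
    · exact (hx b hb h).le.trans (le_csSup hbdd ⟨m, hm, rfl⟩)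
  · exact csSup_le_csSup (hS.image _).bddAbove (Set.Nonempty.image _ ⟨m, hm⟩) (image_mono hsub)

/-- Near a point, a finite minimum of continuous functions is attained among the functions that
attain it at that point. -/
theorem Set.Finite.eventually_sInf_image_eq_argmin {S : Set β} (hS : S.Finite) (hne : S.Nonempty)
    {φ : β → X → L} (hφ : ∀ b, Continuous (φ b)) (x₀ : X) :
    ∀ᶠ x in 𝓝 x₀, sInf ((fun b => φ b x) '' S) =
      sInf ((fun b => φ b x) '' {b ∈ S | φ b x₀ = sInf ((fun b => φ b x₀) '' S)}) :=
  Set.Finite.eventually_sSup_image_eq_argmax (L := Lᵒᵈ) hS hne hφ x₀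

end FiniteSup

section Real

variable {β : Type*}

theorem Real.sSup_image_const_add {S : Set β} (hS : S.Finite) (hne : S.Nonempty)
    (v : ℝ) (φ : β → ℝ) :
    sSup ((fun b => v + φ b) '' S) = v + sSup (φ '' S) := by
  have h := (OrderIso.addLeft v).map_csSup' (hne.image φ) (hS.image φ).bddAbove
  rw [image_image] at h
  simpa using h.symm

theorem Real.sInf_image_const_add {S : Set β} (hS : S.Finite) (hne : S.Nonempty)
    (v : ℝ) (φ : β → ℝ) :
    sInf ((fun b => v + φ b) '' S) = v + sInf (φ '' S) := by
  have h := (OrderIso.addLeft v).map_csInf' (hne.image φ) (hS.image φ).bddBelow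
  rw [image_image] at h
  simpa using h.symm

theorem Real.sSup_image_const_mul {t : ℝ} (ht : 0 ≤ t) (S : Set β) (φ : β → ℝ) :
    sSup ((fun b => t * φ b) '' S) = t * sSup (φ '' S) := by
  have h := Real.sSup_smul_of_nonneg ht (φ '' S)
  rwa [← image_smul, image_image] at h

theorem Real.sInf_image_const_mul {t : ℝ} (ht : 0 ≤ t) (S : Set β) (φ : β → ℝ) :
    sInf ((fun b => t * φ b) '' S) = t * sInf (φ '' S) := by
  have h := Real.sInf_smul_of_nonneg ht (φ '' S)
  rwa [← image_smul, image_image] at h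

end Real


/-- A piecewise affine map
`f_j(x) = min_{a ∈ A j} max_{b ∈ B a} (⟨c a b, x⟩ + r a b)` (finite nonempty index sets,
min/max written via `sInf`/`sSup` of images) is semidifferentiable at every `u ∈ ℝ^d`
(sup-norm on `ℝ^d = Fin d → ℝ`), with semidifferential
`D_j(h) = min_{a ∈ Ā j} max_{b ∈ B̄ a} ⟨c a b, h⟩`, where
`Ā j = {a ∈ A j | f_j(u) = max_{b ∈ B a} (⟨c a b, u⟩ + r a b)}` and
`B̄ a = {b ∈ B a | ⟨c a b, u⟩ + r a b = max_{b' ∈ B a} (⟨c a b', u⟩ + r a b')}`: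
`D` is continuous, positively homogeneous, and `f(u+h) = f(u) + D(h) + o(‖h‖)`. -/
theorem piecewise_affine_semidifferentiable
    {d : ℕ} {α β : Type*}
    (A : Fin d → Set α) (B : α → Set β)
    (hAfin : ∀ j, (A j).Finite) (hAne : ∀ j, (A j).Nonempty)
    (hBfin : ∀ a, (B a).Finite) (hBne : ∀ a, (B a).Nonempty)
    (c : α → β → Fin d → ℝ) (r : α → β → ℝ)
    (f : (Fin d → ℝ) → (Fin d → ℝ))
    (hf : ∀ x : Fin d → ℝ, ∀ j : Fin d, f x j =
      sInf ((fun a => sSup ((fun b => (∑ i, c a b i * x i) + r a b) '' B a)) '' A j))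
    (u : Fin d → ℝ)
    (D : (Fin d → ℝ) → (Fin d → ℝ))
    (hD : ∀ h : Fin d → ℝ, ∀ j : Fin d, D h j =
      sInf ((fun a => sSup ((fun b => ∑ i, c a b i * h i) ''
          {b ∈ B a | (∑ i, c a b i * u i) + r a b =
            sSup ((fun b' => (∑ i, c a b' i * u i) + r a b') '' B a)})) ''
        {a ∈ A j | f u j =
          sSup ((fun b => (∑ i, c a b i * u i) + r a b) '' B a)})) :
    Continuous D ∧
      (∀ t : ℝ, 0 < t → ∀ x : Fin d → ℝ, D (t • x) = t • D x) ∧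
      (fun h => f (u + h) - f u - D h) =o[nhds (0 : Fin d → ℝ)] fun h => ‖h‖ := by
  have hTne (a : α) := (hBfin a).nonempty_argmax (hBne a) (fun b => (∑ i, c a b i * u i) + r a b)
  have hTfin (a : α) := (hBfin a).subset
    (sep_subset (B a) fun b => (∑ i, c a b i * u i) + r a b =
      sSup ((fun b' => (∑ i, c a b' i * u i) + r a b') '' B a))
  have hMne : ∀ j, {a ∈ A j | f u j =
      sSup ((fun b => (∑ i, c a b i * u i) + r a b) '' B a)}.Nonempty := by
    intro j
    simpa only [hf u j, eq_comm] using (hAfin j).nonempty_argmin (hAne j)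
      (fun a => sSup ((fun b => (∑ i, c a b i * u i) + r a b) '' B a))
  have hMfin (j : Fin d) := (hAfin j).subset
    (sep_subset (A j) fun a => f u j = sSup ((fun b => (∑ i, c a b i * u i) + r a b) '' B a))
  refine ⟨?_, ?_, ?_⟩
  · refine continuous_pi fun j => ?_
    simp only [hD]
    exact (hMfin j).continuous_sInf_image (hMne j) fun a =>
      (hTfin a).continuous_sSup_image (hTne a) fun b => by fun_prop
  · intro t ht x
    ext j
    have hlin (a : α) (b : β) : ∑ i, c a b i * (t • x) i = t * ∑ i, c a b i * x i := by
      simp only [Pi.smul_apply, smul_eq_mul, Finset.mul_sum, mul_left_comm]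
    simp only [Pi.smul_apply t (D x), smul_eq_mul, hD, hlin, Real.sSup_image_const_mul ht.le,
      Real.sInf_image_const_mul ht.le]
  · have hlocal : ∀ᶠ h in 𝓝 (0 : Fin d → ℝ), ∀ j, f (u + h) j = f u j + D h j := by
      rw [eventually_all]
      intro j
      have hmax : ∀ᶠ h in 𝓝 (0 : Fin d → ℝ), ∀ a ∈ A j, _ := (hAfin j).eventually_all.2 fun a _ =>
        (hBfin a).eventually_sSup_image_eq_argmax (hBne a)
          (φ := fun b (h : Fin d → ℝ) => (∑ i, c a b i * (u + h) i) + r a b)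
          (fun b => by simp only [Pi.add_apply]; fun_prop) 0
      have hmin := (hAfin j).eventually_sInf_image_eq_argmin (hAne j)
        (φ := fun a (h : Fin d → ℝ) =>
          sSup ((fun b => (∑ i, c a b i * (u + h) i) + r a b) '' B a))
        (fun a => (hBfin a).continuous_sSup_image (hBne a)
          fun b => by simp only [Pi.add_apply]; fun_prop) 0
      filter_upwards [hmax, hmin] with h hmax hmin
      simp only [add_zero] at hmax hmin
      rw [hf (u + h), hmin, hD, ← Real.sInf_image_const_add (hMfin j) (hMne j)]
      simp only [← hf u j, eq_comm (b := f u j)]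
      congr 1
      refine image_congr fun a ha => ?_
      rw [hmax a ha.1, ha.2, ← Real.sSup_image_const_add (hTfin a) (hTne a)]
      congr 1
      refine image_congr fun b hb => ?_
      rw [← hb.2]
      simp only [Pi.add_apply, mul_add, Finset.sum_add_distrib]
      ring
    refine (Asymptotics.isLittleO_zero _ _).congr' ?_ EventuallyEq.rfl
    filter_upwards [hlocal] with h hh
    ext j
    simp [hh j]
end

section
/- Let f : ℝ^d → ℝ^d be piecewise affine, with f_j(x) = min_{a ∈ A_j} max_{b ∈ B_a} (⟨c_{a,b}, x⟩ + r_{a,b}) for finite nonempty index sets A_j and B_a, vectors c_{a,b} ∈ ℝ^d and scalars r_{a,b}, and let u ∈ ℝ^d. Define D : ℝ^d → ℝ^d coordinatewise by D_j(h) = min_{a ∈ Ā_j} max_{b ∈ B̄_a} ⟨c_{a,b}, h⟩, where Ā_j = {a ∈ A_j : f_j(u) = max_{b ∈ B_a} (⟨c_{a,b}, u⟩ + r_{a,b})} and B̄_a = {b ∈ B_a : ⟨c_{a,b}, u⟩ + r_{a,b} = max_{b' ∈ B_a} (⟨c_{a,b'}, u⟩ + r_{a,b'})}. Then there is a neighborhood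 V of 0 in ℝ^d such that for all h ∈ V, f(u+h) = f(u) + D(h) exactly. -/
open Filter Topology

/-- A finite maximum of real functions `F i x = v i + L i x` with `L i → 0` is eventually the
maximum of the `v i` plus the maximum of the `L i` over the indices where `v` is maximal. -/
theorem eventually_sSup_image_eq_add {ι X : Type*} {l : Filter X} {S : Set ι} (hS : S.Finite)
    (hne : S.Nonempty) {F L : ι → X → ℝ} {v : ι → ℝ}
    (hF : ∀ᶠ x in l, ∀ i ∈ S, F i x = v i + L i x) (hL : ∀ i ∈ S, Tendsto (L i) l (𝓝 0)) :
    ∀ᶠ x in l, sSup ((fun i => F i x) '' S) =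
      sSup (v '' S) + sSup ((fun i => L i x) '' {i ∈ S | v i = sSup (v '' S)}) := by
  set M := sSup (v '' S) with hM
  obtain ⟨t, htS, htM⟩ : M ∈ v '' S := (hne.image v).csSup_mem (hS.image v)
  have hlt : ∀ᶠ x in l, ∀ i ∈ S, v i < M → v i + L i x < M + L t x := by
    refine (eventually_all_finite hS).2 fun i hi => ?_
    by_cases hv : v i < M
    · have h₁ : Tendsto (fun x => v i + L i x) l (𝓝 (v i + 0)) := (hL i hi).const_add _
      have h₂ : Tendsto (fun x => M + L t x) l (𝓝 (M + 0)) := (hL t htS).const_add _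
      filter_upwards [h₁.eventually_lt h₂ (by simpa using hv)] with x hx _ using hx
    · exact Eventually.of_forall fun x h => absurd h hv
  filter_upwards [hF, hlt] with x hFx hx
  have hT : {i ∈ S | v i = M}.Finite := hS.subset (Set.sep_subset _ _)
  have hTbdd : BddAbove ((fun i => L i x) '' {i ∈ S | v i = M}) := (hT.image _).bddAbove
  have hT_le : ∀ i ∈ S, v i = M → L i x ≤ sSup ((fun i => L i x) '' {i ∈ S | v i = M}) :=
    fun i hi hv => le_csSup hTbdd ⟨i, ⟨hi, hv⟩, rfl⟩
  have hTne : {i ∈ S | v i = M}.Nonempty := ⟨t, htS, htM⟩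
  obtain ⟨s, ⟨hsS, hsM⟩, hs⟩ := (hTne.image fun i => L i x).csSup_mem (hT.image _)
  apply le_antisymm
  · refine csSup_le (hne.image _) ?_
    rintro _ ⟨i, hi, rfl⟩
    have hvi : v i ≤ M := le_csSup (hS.image v).bddAbove ⟨i, hi, rfl⟩
    simp only [hFx i hi]
    rcases hvi.lt_or_eq with hv | hv
    · linarith [hx i hi hv, hT_le t htS htM]
    · linarith [hT_le i hi hv]
  · rw [← hs]
    refine le_csSup (hS.image _).bddAbove ⟨s, hsS, ?_⟩
    simp only [hFx s hsS, hsM]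

theorem sInf_image_eq_neg_sSup_image_neg {ι : Type*} (S : Set ι) (g : ι → ℝ) :
    sInf (g '' S) = -sSup ((fun i => -g i) '' S) := by
  rw [Real.sInf_def, ← Set.image_neg_eq_neg, Set.image_image]

/-- The analogue of `eventually_sSup_image_eq_add` for finite minima. -/
theorem eventually_sInf_image_eq_add {ι X : Type*} {l : Filter X} {S : Set ι} (hS : S.Finite)
    (hne : S.Nonempty) {F L : ι → X → ℝ} {v : ι → ℝ}
    (hF : ∀ᶠ x in l, ∀ i ∈ S, F i x = v i + L i x) (hL : ∀ i ∈ S, Tendsto (L i) l (𝓝 0)) :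
    ∀ᶠ x in l, sInf ((fun i => F i x) '' S) =
      sInf (v '' S) + sInf ((fun i => L i x) '' {i ∈ S | sInf (v '' S) = v i}) := by
  have key := eventually_sSup_image_eq_add (F := fun i x => -F i x) (L := fun i x => -L i x)
    (v := fun i => -v i) hS hne
    (hF.mono fun x hx i hi => by rw [hx i hi, neg_add])
    (fun i hi => by simpa using (hL i hi).neg)
  filter_upwards [key] with x hx
  have hset : {i ∈ S | sInf (v '' S) = v i} =
      {i ∈ S | -v i = sSup ((fun i => -v i) '' S)} := by
    ext i
    simp only [sInf_image_eq_neg_sSup_image_neg S v, Set.mem_ofPred_eq, neg_eq_iff_eq_neg,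
      eq_comm]
  rw [hset, sInf_image_eq_neg_sSup_image_neg, hx, sInf_image_eq_neg_sSup_image_neg S v,
    sInf_image_eq_neg_sSup_image_neg, neg_add]

theorem tendsto_sSup_image_zero {ι X : Type*} {l : Filter X} {T : Set ι} (hT : T.Finite)
    (hne : T.Nonempty) {L : ι → X → ℝ} (hL : ∀ i ∈ T, Tendsto (L i) l (𝓝 0)) :
    Tendsto (fun x => sSup ((fun i => L i x) '' T)) l (𝓝 0) := by
  refine tendsto_def.2 fun U hU => ?_
  filter_upwards [(eventually_all_finite hT).2 fun i hi => (hL i hi).eventually_mem hU] with x hx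
  obtain ⟨s, hs, hsx⟩ := (hne.image fun i => L i x).csSup_mem (hT.image _)
  rw [Set.mem_preimage, ← hsx]
  exact hx s hs


/-- For a piecewise affine map
`f_j(x) = min_{a ∈ A j} max_{b ∈ B a} (⟨c a b, x⟩ + r a b)` and `u ∈ ℝ^d`, the map
`D_j(h) = min_{a ∈ Ā j} max_{b ∈ B̄ a} ⟨c a b, h⟩` (with `Ā j`, `B̄ a` the argmin/argmax
sets at `u`) satisfies `f(u+h) = f(u) + D(h)` exactly for all `h` in some neighborhood
of `0`. -/
theorem piecewise_affine_eq_semidifferential_near_zero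
    {d : ℕ} {α β : Type*}
    (A : Fin d → Set α) (B : α → Set β)
    (hAfin : ∀ j, (A j).Finite) (hAne : ∀ j, (A j).Nonempty)
    (hBfin : ∀ a, (B a).Finite) (hBne : ∀ a, (B a).Nonempty)
    (c : α → β → Fin d → ℝ) (r : α → β → ℝ)
    (f : (Fin d → ℝ) → (Fin d → ℝ))
    (hf : ∀ x : Fin d → ℝ, ∀ j : Fin d, f x j =
      sInf ((fun a => sSup ((fun b => (∑ i, c a b i * x i) + r a b) '' B a)) '' A j))
    (u : Fin d → ℝ)
    (D : (Fin d → ℝ) → (Fin d → ℝ))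
    (hD : ∀ h : Fin d → ℝ, ∀ j : Fin d, D h j =
      sInf ((fun a => sSup ((fun b => ∑ i, c a b i * h i) ''
          {b ∈ B a | (∑ i, c a b i * u i) + r a b =
            sSup ((fun b' => (∑ i, c a b' i * u i) + r a b') '' B a)})) ''
        {a ∈ A j | f u j =
          sSup ((fun b => (∑ i, c a b i * u i) + r a b) '' B a)})) :
    ∃ V ∈ nhds (0 : Fin d → ℝ), ∀ h ∈ V, f (u + h) = f u + D h := by
  have hlin : ∀ a b, Tendsto (fun h : Fin d → ℝ => ∑ i, c a b i * h i) (𝓝 0) (𝓝 0) := by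
    intro a b
    have hc : Continuous fun h : Fin d → ℝ => ∑ i, c a b i * h i := by fun_prop
    simpa using hc.tendsto 0
  have hmax : ∀ a, ∀ᶠ h in 𝓝 (0 : Fin d → ℝ), _ := fun a =>
    eventually_sSup_image_eq_add (hBfin a) (hBne a)
      (F := fun b h => (∑ i, c a b i * (u + h) i) + r a b)
      (v := fun b => (∑ i, c a b i * u i) + r a b)
      (Eventually.of_forall fun h b _ => by
        simp only [Pi.add_apply, mul_add, Finset.sum_add_distrib]
        ring)
      (fun b _ => hlin a b)
  have hlim := fun a => tendsto_sSup_image_zero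
    (T := {b ∈ B a | (∑ i, c a b i * u i) + r a b =
      sSup ((fun b' => (∑ i, c a b' i * u i) + r a b') '' B a)})
    ((hBfin a).subset (Set.sep_subset _ _))
    (by
      obtain ⟨b, hb, hbM⟩ := ((hBne a).image fun b' =>
        (∑ i, c a b' i * u i) + r a b').csSup_mem ((hBfin a).image _)
      exact ⟨b, hb, hbM⟩)
    (fun b _ => hlin a b)
  have hmin : ∀ᶠ h in 𝓝 (0 : Fin d → ℝ), ∀ j, f (u + h) j = f u j + D h j := by
    refine eventually_all.2 fun j => ?_
    filter_upwards [eventually_sInf_image_eq_add (hAfin j) (hAne j)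
      ((eventually_all_finite (hAfin j)).2 fun a _ => hmax a) (fun a _ => hlim a)] with h hh
    rw [hD, hf (u + h) j, hf u j]
    exact hh
  exact ⟨_, hmin, fun h hh => funext hh⟩
end

section
/- Let f : ℝ^d → ℝ^d be nonexpansive with respect to the sup-norm, and suppose f is semidifferentiable at u ∈ ℝ^d with semidifferential g. Then the following are equivalent: (i) the only h ∈ ℝ^d_- with g(h) = h is h = 0; (ii) the spectral radius ρ_{ℝ^d_-}(g) = sup{λ ≥ 0 : ∃ h ∈ ℝ^d_- \ {0}, g(h) = λh} is strictly less than 1. -/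
/-- A semidifferential of a nonexpansive map is norm-bounded by the identity. -/
lemma norm_semidifferential_le {E : Type*} [NormedAddCommGroup E] [NormedSpace ℝ E] {f g : E → E}
    (hf : ∀ x y, ‖f x - f y‖ ≤ ‖x - y‖) {u : E}
    (hg_hom : ∀ t : ℝ, 0 < t → ∀ x, g (t • x) = t • g x)
    (hg_diff : (fun h => f (u + h) - f u - g h) =o[nhds (0 : E)] fun h => ‖h‖) (x : E) :
    ‖g x‖ ≤ ‖x‖ := by
  have key : ∀ ε : ℝ, 0 < ε → ‖g x‖ ≤ (1 + ε) * ‖x‖ := by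
    intro ε hε
    have hlim : Filter.Tendsto (fun t : ℝ => t • x) (nhdsWithin 0 (Set.Ioi 0)) (nhds 0) := by
      have h : Filter.Tendsto (fun t : ℝ => t • x) (nhds 0) (nhds ((0 : ℝ) • x)) :=
        Continuous.tendsto (by fun_prop) 0
      rw [zero_smul] at h
      exact h.mono_left nhdsWithin_le_nhds
    obtain ⟨t, hbound, (ht : 0 < t)⟩ :=
      ((hlim.eventually (hg_diff.def hε)).and self_mem_nhdsWithin).exists
    have hfu := hf (u + t • x) u
    have htri := norm_sub_norm_le (g (t • x)) (f (u + t • x) - f u)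
    rw [norm_sub_rev (g (t • x))] at htri
    rw [add_sub_cancel_left] at hfu
    rw [norm_norm] at hbound
    have hscaled : ‖g (t • x)‖ ≤ (1 + ε) * ‖t • x‖ := by linarith
    rw [hg_hom t ht, norm_smul, norm_smul, Real.norm_of_nonneg ht.le] at hscaled
    refine le_of_mul_le_mul_left ?_ ht
    linarith
  refine le_of_forall_pos_le_add fun ε hε => ?_
  have h := key (ε / (‖x‖ + 1)) (by positivity)
  have : ε / (‖x‖ + 1) * ‖x‖ ≤ ε := by
    rw [div_mul_eq_mul_div, div_le_iff₀ (by positivity)]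
    nlinarith [norm_nonneg x]
  linarith

/-- The nonnegative eigenvalues, with nonpositive eigenvectors, of a continuous positively
homogeneous map bounded by the identity form a compact set. -/
lemma isCompact_nonpos_eigenvalues {d : ℕ} {g : (Fin d → ℝ) → (Fin d → ℝ)}
    (hg_cont : Continuous g)
    (hg_hom : ∀ t : ℝ, 0 < t → ∀ x, g (t • x) = t • g x)
    (hg_norm : ∀ x, ‖g x‖ ≤ ‖x‖) :
    IsCompact {l : ℝ | 0 ≤ l ∧ ∃ x : Fin d → ℝ, x ≤ 0 ∧ x ≠ 0 ∧ g x = l • x} := by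
  have hK : IsCompact ((Set.Icc (0 : ℝ) 1 ×ˢ Metric.sphere (0 : Fin d → ℝ) 1) ∩
      {p | p.2 ≤ 0 ∧ g p.2 = p.1 • p.2}) := by
    refine (isCompact_Icc.prod (isCompact_sphere _ _)).inter_right (IsClosed.inter ?_ ?_)
    · exact isClosed_le continuous_snd continuous_const
    · exact isClosed_eq (by fun_prop) (by fun_prop)
  convert hK.image continuous_fst using 1
  ext l
  constructor
  · rintro ⟨hl, x, hx, hx0, hgx⟩
    have hpos : 0 < ‖x‖ := norm_pos_iff.mpr hx0
    have hl1 : l ≤ 1 := by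
      have h := hg_norm x
      rw [hgx, norm_smul, Real.norm_of_nonneg hl] at h
      exact le_of_mul_le_mul_right (by linarith) hpos
    refine ⟨(l, ‖x‖⁻¹ • x), ⟨⟨⟨hl, hl1⟩, ?_⟩, ?_, ?_⟩, rfl⟩
    · simp [norm_smul, hpos.ne']
    · exact smul_nonpos_of_nonneg_of_nonpos (inv_nonneg.mpr hpos.le) hx
    · simp only [hg_hom _ (inv_pos.mpr hpos), hgx, smul_comm l]
  · rintro ⟨⟨m, x⟩, ⟨⟨hm, hx⟩, hx0, hgx⟩, rfl⟩
    exact ⟨hm.1, x, hx0, ne_zero_of_mem_unit_sphere ⟨x, hx⟩, hgx⟩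


/-- Let `f : ℝ^d → ℝ^d` be nonexpansive for the sup-norm and
semidifferentiable at `u` with semidifferential `g`. Then the following are equivalent:
(i) the only `h ∈ ℝ^d_-` with `g h = h` is `h = 0`;
(ii) the spectral radius `ρ_{ℝ^d_-}(g) = sup {λ ≥ 0 : ∃ h ∈ ℝ^d_- \ {0}, g h = λ h}`
is strictly less than `1`. -/
theorem no_nonzero_nonpositive_fixed_point_iff_spectral_radius_lt_one
    {d : ℕ} (f : (Fin d → ℝ) → (Fin d → ℝ))
    (hf : ∀ x y : Fin d → ℝ, ‖f x - f y‖ ≤ ‖x - y‖)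
    (u : Fin d → ℝ)
    (g : (Fin d → ℝ) → (Fin d → ℝ))
    (hg_cont : Continuous g)
    (hg_hom : ∀ t : ℝ, 0 < t → ∀ x : Fin d → ℝ, g (t • x) = t • g x)
    (hg_diff : (fun h => f (u + h) - f u - g h)
      =o[nhds (0 : Fin d → ℝ)] fun h => ‖h‖) :
    (∀ h : Fin d → ℝ, h ≤ 0 → g h = h → h = 0) ↔
      sSup {l : ℝ | 0 ≤ l ∧ ∃ x : Fin d → ℝ, x ≤ 0 ∧ x ≠ 0 ∧ g x = l • x} < 1 := by
  have hnorm := norm_semidifferential_le hf hg_hom hg_diff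
  have hcompact := isCompact_nonpos_eigenvalues hg_cont hg_hom hnorm
  constructor
  · intro hfix
    rcases Set.eq_empty_or_nonempty
      {l : ℝ | 0 ≤ l ∧ ∃ x : Fin d → ℝ, x ≤ 0 ∧ x ≠ 0 ∧ g x = l • x} with hempty | hne
    · simp [hempty]
    · obtain ⟨hl, x, hx, hx0, hgx⟩ := hcompact.sSup_mem hne
      by_contra! hge
      have h := hnorm x
      rw [hgx, norm_smul, Real.norm_of_nonneg hl] at h
      have hle := le_of_mul_le_mul_right (h.trans_eq (one_mul _).symm) (norm_pos_iff.mpr hx0)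
      rw [le_antisymm hle hge, one_smul] at hgx
      exact hx0 (hfix x hx hgx)
  · intro hlt h hh hgh
    by_contra h0
    exact hlt.not_ge (le_csSup hcompact.bddAbove
      ⟨zero_le_one, h, hh, h0, by rw [one_smul, hgh]⟩)
end

section
/- Let f : ℝ^d → ℝ^d be monotone and nonexpansive with respect to the sup-norm, and suppose f has at least one fixed point. Then there exists a map P : ℝ^d → ℝ^d which is monotone and nonexpansive, whose range P(ℝ^d) equals the fixed point set Fix(f) = {x : f(x) = x}, and whose fixed point set Fix(P) also equals Fix(f); in particular P is a monotone nonexpansive retraction of ℝ^d onto Fix(f). -/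
open Filter Topology Function

section Subtopical

variable {ι : Type*}

/-- Subtopical maps of `ℝ^ι`: those which preserve every inequality `x ≤ y + c`, `c ≥ 0`.
For finite `ι` these are exactly the monotone sup-norm nonexpansive maps. -/
def IsSubtopical (g : (ι → ℝ) → (ι → ℝ)) : Prop :=
  ∀ c : ℝ, 0 ≤ c → ∀ x y : ι → ℝ, x ≤ y + const ι c → g x ≤ g y + const ι c

theorem le_add_const_norm_sub [Fintype ι] (x y : ι → ℝ) : x ≤ y + const ι ‖x - y‖ := by
  intro i
  have h := (le_abs_self _).trans (norm_le_pi_norm (x - y) i)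
  simp only [Pi.sub_apply, Pi.add_apply, const_apply] at h ⊢
  linarith

theorem norm_sub_le_of_le_add_const [Fintype ι] {x y : ι → ℝ} {c : ℝ} (hc : 0 ≤ c)
    (hxy : x ≤ y + const ι c) (hyx : y ≤ x + const ι c) : ‖x - y‖ ≤ c := by
  refine (pi_norm_le_iff_of_nonneg hc).2 fun i => abs_le.2 ?_
  have h₁ := hxy i
  have h₂ := hyx i
  simp only [Pi.sub_apply, Pi.add_apply, const_apply] at h₁ h₂ ⊢
  constructor <;> linarith

theorem isSubtopical_of_monotone_of_nonexpansive [Fintype ι] {g : (ι → ℝ) → (ι → ℝ)}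
    (hmono : Monotone g) (hne : ∀ x y, ‖g x - g y‖ ≤ ‖x - y‖) : IsSubtopical g := by
  intro c hc x y hxy
  have hy : y ≤ y + const ι c := le_add_of_nonneg_right fun _ => hc
  have hsup : ‖x ⊔ y - y‖ ≤ c :=
    norm_sub_le_of_le_add_const hc (sup_le hxy hy)
      (le_sup_right.trans (le_add_of_nonneg_right fun _ => hc))
  calc g x ≤ g (x ⊔ y) := hmono le_sup_left
    _ ≤ g y + const ι ‖g (x ⊔ y) - g y‖ := le_add_const_norm_sub _ _
    _ ≤ g y + const ι c := add_le_add_right (fun _ => (hne _ _).trans hsup) _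

namespace IsSubtopical

variable {g h : (ι → ℝ) → (ι → ℝ)}

theorem monotone (hg : IsSubtopical g) : Monotone g := by
  intro x y hxy
  have hzero : const ι (0 : ℝ) = 0 := rfl
  simpa [hzero] using hg 0 le_rfl x y (by simpa [hzero] using hxy)

theorem norm_sub_le [Fintype ι] (hg : IsSubtopical g) (x y : ι → ℝ) :
    ‖g x - g y‖ ≤ ‖x - y‖ :=
  norm_sub_le_of_le_add_const (norm_nonneg _)
    (hg _ (norm_nonneg _) _ _ (le_add_const_norm_sub x y))
    (hg _ (norm_nonneg _) _ _ (norm_sub_rev x y ▸ le_add_const_norm_sub y x))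

theorem continuous [Fintype ι] (hg : IsSubtopical g) : Continuous g :=
  (LipschitzWith.of_dist_le' (K := 1) fun x y => by
    simpa [dist_eq_norm] using hg.norm_sub_le x y).continuous

theorem comp (hg : IsSubtopical g) (hh : IsSubtopical h) : IsSubtopical (g ∘ h) :=
  fun c hc x y hxy => hg c hc _ _ (hh c hc x y hxy)

theorem iterate (hg : IsSubtopical g) : ∀ n : ℕ, IsSubtopical g^[n]
  | 0 => fun _ _ _ _ hxy => hxy
  | n + 1 => (hg.iterate n).comp hg

theorem iSup {κ : Type*} [Nonempty κ] {G : κ → (ι → ℝ) → (ι → ℝ)}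
    (hG : ∀ k, IsSubtopical (G k)) (hbdd : ∀ x, BddAbove (Set.range fun k => G k x)) :
    IsSubtopical fun x => ⨆ k, G k x := fun c hc x y hxy =>
  ciSup_le fun k => (hG k c hc x y hxy).trans (add_le_add_left (le_ciSup (hbdd y) k) _)

theorem iInf {κ : Type*} [Nonempty κ] {G : κ → (ι → ℝ) → (ι → ℝ)}
    (hG : ∀ k, IsSubtopical (G k)) (hbdd : ∀ x, BddBelow (Set.range fun k => G k x)) :
    IsSubtopical fun x => ⨅ k, G k x := fun c hc x y hxy =>
  sub_le_iff_le_add.1 <| le_ciInf fun k =>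
    sub_le_iff_le_add.2 <| (ciInf_le (hbdd x) k).trans (hG k c hc x y hxy)

theorem iterate_mem_Icc [Fintype ι] (hg : IsSubtopical g) {p : ι → ℝ} (hp : IsFixedPt g p)
    (x : ι → ℝ) (n : ℕ) :
    g^[n] x ∈ Set.Icc (p - const ι ‖x - p‖) (p + const ι ‖x - p‖) := by
  have hpn : g^[n] p = p := hp.iterate n
  have h₁ := (hg.iterate n) _ (norm_nonneg _) _ _ (le_add_const_norm_sub x p)
  have h₂ := (hg.iterate n) _ (norm_nonneg _) _ _ (le_add_const_norm_sub p x)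
  rw [hpn] at h₁ h₂
  rw [norm_sub_rev p x] at h₂
  exact ⟨sub_le_iff_le_add.2 h₂, h₁⟩

end IsSubtopical

/-- The componentwise upper limit of the orbit of `x` under `g`. -/
noncomputable def orbitLimsup (g : (ι → ℝ) → (ι → ℝ)) (x : ι → ℝ) : ι → ℝ :=
  ⨅ n : ℕ, ⨆ l : ℕ, g^[l + n] x

/-- The supremum of the orbit, under `g`, of the upper limit of the orbit of `x`. -/
noncomputable def fixedPointRetraction (g : (ι → ℝ) → (ι → ℝ)) (x : ι → ℝ) : ι → ℝ :=
  ⨆ k : ℕ, g^[k] (orbitLimsup g x)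

theorem fixedPointRetraction_eq_self {g : (ι → ℝ) → (ι → ℝ)} {x : ι → ℝ}
    (hx : IsFixedPt g x) : fixedPointRetraction g x = x := by
  have hiter : ∀ n : ℕ, g^[n] x = x := fun n => hx.iterate n
  simp only [fixedPointRetraction, orbitLimsup, hiter, ciSup_const, ciInf_const]

namespace IsSubtopical

variable [Fintype ι] {g : (ι → ℝ) → (ι → ℝ)} {p : ι → ℝ}

theorem bddAbove_range_iterate (hg : IsSubtopical g) (hp : IsFixedPt g p) (x : ι → ℝ)
    (n : ℕ) : BddAbove (Set.range fun l : ℕ => g^[l + n] x) :=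
  ⟨_, Set.forall_mem_range.2 fun l => (hg.iterate_mem_Icc hp x (l + n)).2⟩

theorem bddBelow_range_iSup_iterate (hg : IsSubtopical g) (hp : IsFixedPt g p) (x : ι → ℝ) :
    BddBelow (Set.range fun n : ℕ => ⨆ l : ℕ, g^[l + n] x) :=
  ⟨_, Set.forall_mem_range.2 fun n => (hg.iterate_mem_Icc hp x (0 + n)).1.trans
    (le_ciSup (hg.bddAbove_range_iterate hp x n) 0)⟩

theorem orbitLimsup (hg : IsSubtopical g) (hp : IsFixedPt g p) :
    IsSubtopical (orbitLimsup g) :=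
  .iInf (fun n => .iSup (fun l => hg.iterate (l + n))
    fun x => hg.bddAbove_range_iterate hp x n) (hg.bddBelow_range_iSup_iterate hp)

theorem fixedPointRetraction (hg : IsSubtopical g) (hp : IsFixedPt g p) :
    IsSubtopical (fixedPointRetraction g) :=
  .iSup (fun k => (hg.iterate k).comp (hg.orbitLimsup hp))
    fun x => hg.bddAbove_range_iterate hp (_root_.orbitLimsup g x) 0

theorem orbitLimsup_le_map (hg : IsSubtopical g) (hp : IsFixedPt g p) (x : ι → ℝ) :
    _root_.orbitLimsup g x ≤ g (_root_.orbitLimsup g x) := by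
  have hbdd := hg.bddAbove_range_iterate hp x
  have hanti : Antitone fun n : ℕ => ⨆ l : ℕ, g^[l + n] x :=
    antitone_nat_of_succ_le fun n => ciSup_le fun l => by
      simpa only [← add_assoc, Nat.add_right_comm l 1 n] using le_ciSup (hbdd n) (l + 1)
  have hlim := tendsto_atTop_ciInf hanti (hg.bddBelow_range_iSup_iterate hp x)
  refine ge_of_tendsto' ((hg.continuous.tendsto _).comp hlim) fun n => ?_
  refine (ciInf_le (hg.bddBelow_range_iSup_iterate hp x) (n + 1)).trans (ciSup_le fun l => ?_)
  rw [← add_assoc, iterate_succ_apply']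
  exact hg.monotone (le_ciSup (hbdd n) l)

theorem isFixedPt_fixedPointRetraction (hg : IsSubtopical g) (hp : IsFixedPt g p)
    (x : ι → ℝ) : IsFixedPt g (_root_.fixedPointRetraction g x) :=
  isFixedPt_of_tendsto_iterate
    (tendsto_atTop_ciSup (hg.monotone.monotone_iterate_of_le_map (hg.orbitLimsup_le_map hp x))
      (hg.bddAbove_range_iterate hp _ 0))
    hg.continuous.continuousAt

end IsSubtopical

end Subtopical


/-- Let `f : ℝ^d → ℝ^d` be monotone (for the componentwise order) and
nonexpansive (for the sup-norm), with at least one fixed point. Then there is a monotone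
nonexpansive map `P` whose range is `Fix(f)` and whose fixed point set is `Fix(f)`;
in particular `P` is a monotone nonexpansive retraction of `ℝ^d` onto `Fix(f)`. -/
theorem exists_monotone_nonexpansive_retraction_onto_fixed_points
    {d : ℕ} (f : (Fin d → ℝ) → (Fin d → ℝ))
    (hf_mono : Monotone f)
    (hf_ne : ∀ x y : Fin d → ℝ, ‖f x - f y‖ ≤ ‖x - y‖)
    (hfix : ∃ x : Fin d → ℝ, f x = x) :
    ∃ P : (Fin d → ℝ) → (Fin d → ℝ),
      Monotone P ∧
      (∀ x y : Fin d → ℝ, ‖P x - P y‖ ≤ ‖x - y‖) ∧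
      Set.range P = {x : Fin d → ℝ | f x = x} ∧
      {x : Fin d → ℝ | P x = x} = {x : Fin d → ℝ | f x = x} := by
  obtain ⟨p, hp⟩ := hfix
  have hf := isSubtopical_of_monotone_of_nonexpansive hf_mono hf_ne
  have hP := hf.fixedPointRetraction hp
  have hPfix := hf.isFixedPt_fixedPointRetraction hp
  refine ⟨fixedPointRetraction f, hP.monotone, hP.norm_sub_le, ?_, ?_⟩
  · exact Set.Subset.antisymm (Set.range_subset_iff.2 hPfix)
      fun x hx => ⟨x, fixedPointRetraction_eq_self hx⟩
  · refine Set.Subset.antisymm (fun x hx => ?_) fun x hx => fixedPointRetraction_eq_self hx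
    have hx' : fixedPointRetraction f x = x := hx
    exact hx' ▸ hPfix x
end

section
/- Let f : ℝ^d → ℝ^d be monotone and nonexpansive with respect to the sup-norm, and suppose f has a fixed point. Then for every x ∈ ℝ^d the orbit (f^k(x))_{k ≥ 0} is bounded, so that Q(x) := limsup_{k→∞} f^k(x) (taken coordinatewise) is a well-defined vector in ℝ^d, and Q(x) satisfies f(Q(x)) ≥ Q(x); consequently the sequence (f^l(Q(x)))_{l ≥ 0} is nondecreasing and converges to a fixed point of f. -/
open Filter Topology

/-- The orbit of a nonexpansive map stays within its initial distance to a fixed point. -/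
theorem norm_iterate_sub_fixedPoint_le {E : Type*} [SeminormedAddCommGroup E] {f : E → E}
    (hf : ∀ x y, ‖f x - f y‖ ≤ ‖x - y‖) {p : E} (hp : f p = p) (z : E) (k : ℕ) :
    ‖f^[k] z - p‖ ≤ ‖z - p‖ := by
  induction k with
  | zero => simp
  | succ k ih =>
    rw [Function.iterate_succ_apply']
    calc ‖f (f^[k] z) - p‖ = ‖f (f^[k] z) - f p‖ := by rw [hp]
      _ ≤ ‖f^[k] z - p‖ := hf _ _
      _ ≤ ‖z - p‖ := ih

theorem norm_iterate_le {E : Type*} [SeminormedAddCommGroup E] {f : E → E}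
    (hf : ∀ x y, ‖f x - f y‖ ≤ ‖x - y‖) {p : E} (hp : f p = p) (z : E) (k : ℕ) :
    ‖f^[k] z‖ ≤ ‖z - p‖ + ‖p‖ := by
  have h₁ := norm_iterate_sub_fixedPoint_le hf hp z k
  have h₂ := norm_le_norm_sub_add (f^[k] z) p
  linarith

theorem abs_iterate_apply_le {ι : Type*} [Fintype ι] {f : (ι → ℝ) → (ι → ℝ)}
    (hf : ∀ x y, ‖f x - f y‖ ≤ ‖x - y‖) {p : ι → ℝ} (hp : f p = p) (z : ι → ℝ) (k : ℕ)
    (i : ι) : |f^[k] z i| ≤ ‖z - p‖ + ‖p‖ :=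
  (norm_le_pi_norm (f^[k] z) i).trans (norm_iterate_le hf hp z k)

/-- The coordinatewise limsup of a bounded orbit of a monotone sup-norm nonexpansive map `f`
lies below its image under `f`. -/
theorem limsup_iterate_le_map {ι : Type*} [Fintype ι] {f : (ι → ℝ) → (ι → ℝ)}
    (hmono : Monotone f) (hf : ∀ x y, ‖f x - f y‖ ≤ ‖x - y‖) {x : ι → ℝ} {C : ℝ}
    (hC : ∀ k i, |f^[k] x i| ≤ C) :
    (fun i => limsup (fun k : ℕ => f^[k] x i) atTop) ≤
      f (fun i => limsup (fun k : ℕ => f^[k] x i) atTop) := by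
  set Q : ι → ℝ := fun i => limsup (fun k : ℕ => f^[k] x i) atTop with hQ
  intro i
  refine le_of_forall_pos_le_add fun ε hε => ?_
  have hbdd (j : ι) : IsBoundedUnder (· ≤ ·) atTop (fun k : ℕ => f^[k] x j) :=
    isBoundedUnder_of ⟨C, fun k => (abs_le.mp (hC k j)).2⟩
  have hcobdd (j : ι) : IsCoboundedUnder (· ≤ ·) atTop (fun k : ℕ => f^[k] x j) :=
    (isBoundedUnder_of ⟨-C, fun k => (abs_le.mp (hC k j)).1⟩ :
      IsBoundedUnder (· ≥ ·) atTop (fun k : ℕ => f^[k] x j)).isCoboundedUnder_le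
  have hlt : ∀ᶠ k : ℕ in atTop, ∀ j, f^[k] x j < Q j + ε := eventually_all.mpr fun j =>
    eventually_lt_of_limsup_lt (lt_add_of_pos_right (Q j) hε) (hbdd j)
  have hshift : f (fun j => Q j + ε) i ≤ f Q i + ε := by
    have h₁ : ‖f (fun j => Q j + ε) - f Q‖ ≤ ε := by
      refine (hf _ _).trans ((pi_norm_le_iff_of_nonneg hε.le).mpr fun j => ?_)
      simp [abs_of_pos hε]
    have h₂ := (le_abs_self _).trans ((norm_le_pi_norm _ i).trans h₁)
    rw [Pi.sub_apply] at h₂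
    linarith
  refine limsup_le_of_le (hcobdd i) ?_
  obtain ⟨N, hN⟩ := eventually_atTop.mp hlt
  filter_upwards [eventually_ge_atTop (N + 1)] with k hk
  obtain ⟨m, rfl⟩ : ∃ m, k = m + 1 := ⟨k - 1, by omega⟩
  rw [Function.iterate_succ_apply']
  exact (hmono (fun j => (hN m (by omega) j).le) i).trans hshift

/-- Let `f : ℝ^d → ℝ^d` be monotone and nonexpansive (sup-norm), with a
fixed point. Then for every `x` the orbit `(f^[k] x)ₖ` is bounded, so the coordinatewise
limsup `Q = (limsup_k (f^[k] x)_i)_i` is a well-defined vector, `Q ≤ f Q`, the sequence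
`(f^[l] Q)ₗ` is nondecreasing, and it converges to a fixed point of `f`. -/
theorem orbit_limsup_converges_to_fixed_point
    {d : ℕ} (f : (Fin d → ℝ) → (Fin d → ℝ))
    (hf_mono : Monotone f)
    (hf_ne : ∀ x y : Fin d → ℝ, ‖f x - f y‖ ≤ ‖x - y‖)
    (hfix : ∃ x : Fin d → ℝ, f x = x) :
    ∀ x : Fin d → ℝ,
      (∃ C : ℝ, ∀ k : ℕ, ‖f^[k] x‖ ≤ C) ∧
      ∀ Q : Fin d → ℝ,
        Q = (fun i => Filter.limsup (fun k : ℕ => f^[k] x i) Filter.atTop) →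
          Q ≤ f Q ∧
          Monotone (fun l : ℕ => f^[l] Q) ∧
          ∃ y : Fin d → ℝ, f y = y ∧
            Filter.Tendsto (fun l : ℕ => f^[l] Q) Filter.atTop (nhds y) := by
  obtain ⟨p, hp⟩ := hfix
  intro x
  refine ⟨⟨_, norm_iterate_le hf_ne hp x⟩, ?_⟩
  rintro Q rfl
  have hle := limsup_iterate_le_map hf_mono hf_ne (abs_iterate_apply_le hf_ne hp x)
  have hiter := hf_mono.monotone_iterate_of_le_map hle
  refine ⟨hle, hiter, ?_⟩
  set Q : Fin d → ℝ := fun i => limsup (fun k : ℕ => f^[k] x i) atTop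
  have hlim : Tendsto (fun l : ℕ => f^[l] Q) atTop (𝓝 fun i => ⨆ l : ℕ, f^[l] Q i) := by
    refine tendsto_pi_nhds.mpr fun i =>
      tendsto_atTop_ciSup (fun _ _ h => hiter h i) ⟨‖Q - p‖ + ‖p‖, ?_⟩
    rintro _ ⟨l, rfl⟩
    exact (abs_le.mp (abs_iterate_apply_le hf_ne hp Q l i)).2
  have hcont : Continuous f :=
    (LipschitzWith.of_dist_le_mul (K := 1) fun a b => by
      simpa [dist_eq_norm] using hf_ne a b).continuous
  exact ⟨_, isFixedPt_of_tendsto_iterate hlim hcont.continuousAt, hlim⟩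
end

section
/- Let f : ℝ^d → ℝ^d be monotone and nonexpansive with respect to the sup-norm, and let u be a fixed point of f. Then u is a locally minimal fixed point of f if and only if u is the smallest fixed point of f, i.e. u ≤ v for every v with f(v) = v. -/
/-- A continuous monotone self-map of `ι → ℝ` has a fixed point in every order interval `[a, b]`
with `a ≤ f a` and `f b ≤ b`. -/
theorem Monotone.exists_fixedPoint_mem_Icc {ι : Type*} {f : (ι → ℝ) → (ι → ℝ)}
    (hf : Monotone f) (hc : Continuous f) {a b : ι → ℝ} (hab : a ≤ b) (ha : a ≤ f a)
    (hb : f b ≤ b) : ∃ c ∈ Set.Icc a b, f c = c := by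
  have hanti : Antitone fun n => f^[n] b := hf.antitone_iterate_of_map_le hb
  have hlow : ∀ n, a ≤ f^[n] b := by
    intro n
    induction n with
    | zero => exact hab
    | succ n ih =>
      rw [Function.iterate_succ_apply']
      exact ha.trans (hf ih)
  have hlim : Filter.Tendsto (fun n => f^[n] b) Filter.atTop (nhds fun i => ⨅ n, f^[n] b i) := by
    refine tendsto_pi_nhds.2 fun i => tendsto_atTop_ciInf (fun m n h => hanti h i) ⟨a i, ?_⟩
    rintro _ ⟨n, rfl⟩
    exact hlow n i
  exact ⟨_, ⟨ge_of_tendsto' hlim hlow, le_of_tendsto' hlim fun n => hanti n.zero_le⟩,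
    isFixedPt_of_tendsto_iterate hlim hc.continuousAt⟩

/-- For a sup-norm nonexpansive map, a coordinatewise bound `r` on the difference of two arguments
also bounds the coordinates of the difference of their images. -/
theorem abs_map_sub_le_of_nonexpansive {ι : Type*} [Fintype ι] {f : (ι → ℝ) → (ι → ℝ)}
    (hf : ∀ x y, ‖f x - f y‖ ≤ ‖x - y‖) {x y : ι → ℝ} {r : ℝ} (hr : 0 ≤ r)
    (h : ∀ i, |x i - y i| ≤ r) (i : ι) : |f x i - f y i| ≤ r :=
  (norm_le_pi_norm (f x - f y) i).trans ((hf x y).trans ((pi_norm_le_iff_of_nonneg hr).2 h))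

/-- Let `f : ℝ^d → ℝ^d` be monotone (componentwise order) and
nonexpansive (sup-norm), and let `u` be a fixed point of `f`. Then `u` is a locally
minimal fixed point of `f` if and only if `u` is the smallest fixed point of `f`. -/
theorem locally_minimal_iff_smallest_fixed_point
    {d : ℕ} (f : (Fin d → ℝ) → (Fin d → ℝ))
    (hf_mono : Monotone f)
    (hf_ne : ∀ x y : Fin d → ℝ, ‖f x - f y‖ ≤ ‖x - y‖)
    (u : Fin d → ℝ) (hu : f u = u) :
    (∃ V ∈ nhds u, ∀ v ∈ V, f v = v → v ≤ u → v = u) ↔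
      (∀ v : Fin d → ℝ, f v = v → u ≤ v) := by
  refine ⟨?_, fun h => ⟨Set.univ, Filter.univ_mem, fun v _ hv hvu => le_antisymm hvu (h v hv)⟩⟩
  rintro ⟨V, hV, hmin⟩ v hv
  by_contra huv
  obtain ⟨j, hj⟩ : ∃ j, v j < u j := by simpa [Pi.le_def] using huv
  have : Nonempty (Fin d) := ⟨j⟩
  obtain ⟨i, hi⟩ := Finite.exists_max fun k => u k - v k
  have hD : 0 < u i - v i := (sub_pos.2 hj).trans_le (hi j)
  obtain ⟨ε, hε, hball⟩ := Metric.mem_nhds_iff.1 hV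
  obtain ⟨t, ht, htlt⟩ := exists_between (lt_min hε hD)
  obtain ⟨htε, htD⟩ := lt_min_iff.1 htlt
  have hc : Continuous f := (LipschitzWith.of_dist_le_mul (K := 1) fun x y => by
    simpa [dist_eq_norm] using hf_ne x y).continuous
  have hs : 0 ≤ u i - v i - t := by linarith
  -- The interval between `u - t` and `u ⊓ (v + s)`, `s = max (u - v) - t`, is `f`-invariant
  -- and excludes `u`.
  obtain ⟨c, ⟨hac, hcb⟩, hfc⟩ := hf_mono.exists_fixedPoint_mem_Icc hc
    (a := fun k => u k - t) (b := u ⊓ fun k => v k + (u i - v i - t))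
    (le_inf (fun k => by simp [ht.le]) fun k => by have := hi k; dsimp only at this ⊢; linarith)
    (fun k => by
      have := abs_map_sub_le_of_nonexpansive hf_ne (x := fun k => u k - t) (y := u) ht.le
        (fun k => by simp [abs_of_pos ht]) k
      rw [hu] at this
      linarith [(abs_le.1 this).1])
    (le_inf ((hf_mono inf_le_left).trans hu.le) ((hf_mono inf_le_right).trans fun k => by
      have := abs_map_sub_le_of_nonexpansive hf_ne (x := fun k => v k + (u i - v i - t)) (y := v)
        hs (fun k => by simp [abs_of_nonneg hs]) k
      rw [hv] at this
      linarith [(abs_le.1 this).2]))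
  have hcu : c ≤ u := hcb.trans inf_le_left
  have hcV : c ∈ V := hball <| lt_of_le_of_lt ((dist_pi_le_iff ht.le).2 fun k => by
    have h₁ := hac k
    have h₂ := hcu k
    rw [Real.dist_eq, abs_le]
    constructor <;> linarith) htε
  have hci : c i ≤ v i + (u i - v i - t) := (hcb.trans inf_le_right) i
  rw [hmin c hcV hfc hcu] at hci
  linarith
end

section
/- Let f : ℝ^d → ℝ^d be monotone, nonexpansive with respect to the sup-norm, and piecewise affine, with f_j(x) = min_{a ∈ A_j} max_{b ∈ B_a} (⟨c_{a,b}, x⟩ + r_{a,b}) for finite nonempty index sets A_j and B_a, and let u be a fixed point of f. Let D : ℝ^d → ℝ^d be the semidifferential of f at u, given coordinatewise by D_j(h) = min_{a ∈ Ā_j} max_{b ∈ B̄_a} ⟨c_{a,b}, h⟩ with Ā_j = {a ∈ A_j : f_j(u) = max_{b ∈ B_a} (⟨c_{a,b}, u⟩ + r_{a,b})} and B̄_a = {b ∈ B_a : ⟨c_{a,b}, u⟩ + r_{a,b} = max_{b' ∈ B_a} (⟨c_{a,b'}, u⟩ + r_{a,b'})}. Then the following are equivalent: (1) u is the smallest fixed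 point of f (u ≤ v for every v with f(v) = v); (2) the only h ∈ ℝ^d_- with D(h) = h is h = 0; (3) ρ_{ℝ^d_-}(D) = sup{λ ≥ 0 : ∃ h ∈ ℝ^d_- \ {0}, D(h) = λh} < 1. -/
open Filter Topology

/-- The supremum of finitely many infinitesimal perturbations is infinitesimal. -/
lemma tendsto_sSup_image_zero_s11 {ι X : Type*} {l : Filter X} {S : Set ι} (hS : S.Finite)
    (hne : S.Nonempty) {q : ι → X → ℝ} (hq : ∀ b ∈ S, Tendsto (q b) l (𝓝 0)) :
    Tendsto (fun h => sSup ((fun b => q b h) '' S)) l (𝓝 0) := by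
  rw [Metric.tendsto_nhds]
  intro ε hε
  have hall : ∀ᶠ h in l, ∀ b ∈ S, dist (q b h) 0 < ε :=
    (hS.eventually_all).2 fun b hb => Metric.tendsto_nhds.1 (hq b hb) ε hε
  filter_upwards [hall] with h hh
  obtain ⟨b, hb, hb'⟩ := (hne.image (fun b => q b h)).csSup_mem (hS.image _)
  rw [← hb']
  exact hh b hb

/-- A maximum of finitely many functions is, after a small perturbation, determined by the
indices that attain the maximum. -/
lemma eventually_sSup_image_add {ι X : Type*} {l : Filter X} {S : Set ι} (hS : S.Finite)
    (hne : S.Nonempty) (p : ι → ℝ) {q : ι → X → ℝ} (hq : ∀ b ∈ S, Tendsto (q b) l (𝓝 0)) :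
    ∀ᶠ h in l, sSup ((fun b => p b + q b h) '' S) =
      sSup (p '' S) + sSup ((fun b => q b h) '' {b ∈ S | p b = sSup (p '' S)}) := by
  set M := sSup (p '' S)
  set T := {b ∈ S | p b = M}
  have hTS : T ⊆ S := fun b hb => hb.1
  have hTfin : T.Finite := hS.subset hTS
  obtain ⟨b₀, hb₀, hpb₀⟩ := (hne.image p).csSup_mem (hS.image p)
  have hTne : T.Nonempty := ⟨b₀, hb₀, hpb₀⟩
  have hle : ∀ b ∈ S, p b ≤ M := fun b hb =>
    le_csSup (hS.image p).bddAbove (Set.mem_image_of_mem p hb)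
  have hlim := tendsto_sSup_image_zero_s11 hTfin hTne fun b hb => hq b (hTS hb)
  have hlt : ∀ᶠ h in l, ∀ b ∈ S, p b < M →
      p b + q b h < M + sSup ((fun b => q b h) '' T) := by
    refine (hS.eventually_all).2 fun b hb => ?_
    by_cases hbM : p b < M
    · have h1 : Tendsto (fun h => p b + q b h) l (𝓝 (p b + 0)) := (hq b hb).const_add _
      have h2 : Tendsto (fun h => M + sSup ((fun b => q b h) '' T)) l (𝓝 (M + 0)) :=
        hlim.const_add _
      filter_upwards [h1.eventually_lt h2 (by simpa using hbM)] with h hh _ using hh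
    · exact Eventually.of_forall fun h hh => absurd hh hbM
  filter_upwards [hlt] with h hh
  have hbddT := (hTfin.image (fun b => q b h)).bddAbove
  apply le_antisymm
  · refine csSup_le (hne.image _) ?_
    rintro _ ⟨b, hb, rfl⟩
    rcases (hle b hb).lt_or_eq with hb' | hb'
    · exact (hh b hb hb').le
    · have := le_csSup hbddT (Set.mem_image_of_mem (fun b => q b h) (show b ∈ T from ⟨hb, hb'⟩))
      simp only at this ⊢
      linarith
  · obtain ⟨b, hb, hb'⟩ := (hTne.image (fun b => q b h)).csSup_mem (hTfin.image _)
    rw [← hb', ← hb.2]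
    exact le_csSup (hS.image _).bddAbove
      (Set.mem_image_of_mem (fun b => p b + q b h) (hTS hb))

lemma Real.sInf_image_eq_neg_sSup {ι : Type*} (S : Set ι) (g : ι → ℝ) :
    sInf (g '' S) = -sSup ((fun a => -g a) '' S) := by
  rw [Real.sInf_def, ← Set.image_neg_eq_neg, Set.image_image]

/-- The dual of `eventually_sSup_image_add`. -/
lemma eventually_sInf_image_add {ι X : Type*} {l : Filter X} {S : Set ι} (hS : S.Finite)
    (hne : S.Nonempty) (p : ι → ℝ) {q : ι → X → ℝ} (hq : ∀ b ∈ S, Tendsto (q b) l (𝓝 0)) :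
    ∀ᶠ h in l, sInf ((fun b => p b + q b h) '' S) =
      sInf (p '' S) + sInf ((fun b => q b h) '' {b ∈ S | p b = sInf (p '' S)}) := by
  filter_upwards [eventually_sSup_image_add hS hne (fun b => -p b) (q := fun b h => -q b h)
    fun b hb => by simpa using (hq b hb).neg] with h hh
  have hset : {b ∈ S | -p b = sSup ((fun b => -p b) '' S)} = {b ∈ S | p b = sInf (p '' S)} := by
    ext b
    simp only [Set.mem_ofPred_eq, Real.sInf_image_eq_neg_sSup S p, neg_eq_iff_eq_neg]
  rw [hset] at hh
  simp only [Real.sInf_image_eq_neg_sSup, neg_add] at hh ⊢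
  rw [hh]
  ring

/-- A monotone self-map of an order interval in a conditionally complete lattice has a fixed point. -/
lemma Monotone.exists_fixed_mem_Icc {L : Type*} [ConditionallyCompleteLattice L] {f : L → L}
    (hf : Monotone f) {a b : L} (hab : a ≤ b) (ha : a ≤ f a) (hb : f b ≤ b) :
    ∃ x ∈ Set.Icc a b, f x = x := by
  have hbdd : BddAbove {x ∈ Set.Icc a b | x ≤ f x} := ⟨b, fun x hx => hx.1.2⟩
  have hmem : a ∈ {x ∈ Set.Icc a b | x ≤ f x} := ⟨⟨le_rfl, hab⟩, ha⟩
  set s := sSup {x ∈ Set.Icc a b | x ≤ f x}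
  have has : a ≤ s := le_csSup hbdd hmem
  have hsb : s ≤ b := csSup_le ⟨a, hmem⟩ fun x hx => hx.1.2
  have hsf : s ≤ f s := csSup_le ⟨a, hmem⟩ fun x hx => hx.2.trans (hf (le_csSup hbdd hx))
  refine ⟨s, ⟨has, hsb⟩, le_antisymm (le_csSup hbdd ⟨⟨?_, ?_⟩, hf hsf⟩) hsf⟩
  · exact has.trans hsf
  · exact (hf hsb).trans hb

/-- A monotone nonexpansive map with a fixed point `u` and a point `w < u` such that `f w ≤ w`
has fixed points below `u`, different from `u`, and arbitrarily close to `u`. -/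
lemma exists_fixed_lt_near {d : ℕ} {f : (Fin d → ℝ) → (Fin d → ℝ)} (hf_mono : Monotone f)
    (hf_ne : ∀ x y : Fin d → ℝ, ‖f x - f y‖ ≤ ‖x - y‖) {u w : Fin d → ℝ} (hu : f u = u)
    (hw : f w ≤ w) (hwu : w < u) {ε : ℝ} (hε : 0 < ε) :
    ∃ x, f x = x ∧ x < u ∧ ‖x - u‖ ≤ ε := by
  have hR : 0 < ‖u - w‖ := norm_pos_iff.2 (sub_ne_zero.2 hwu.ne')
  set δ := min ε ‖u - w‖
  have hδ0 : 0 < δ := lt_min hε hR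
  have hδR : δ ≤ ‖u - w‖ := min_le_right _ _
  have hshift : ∀ (x : Fin d → ℝ) (s : ℝ) (i : Fin d), |f (fun i => x i + s) i - f x i| ≤ |s| := by
    intro x s i
    refine (norm_le_pi_norm (f (fun i => x i + s) - f x) i).trans ((hf_ne _ _).trans ?_)
    exact (pi_norm_le_iff_of_nonneg (abs_nonneg s)).2 fun i => by simp
  have hcoord : ∀ i, |u i - w i| ≤ ‖u - w‖ := fun i => norm_le_pi_norm (u - w) i
  obtain ⟨x, ⟨hx1, hx2⟩, hx⟩ := hf_mono.exists_fixed_mem_Icc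
    (a := fun i => u i + -δ) (b := u ⊓ fun i => w i + (‖u - w‖ - δ))
    (le_inf (fun i => by simp [hδ0.le])
      (fun i => by have := (abs_le.1 (hcoord i)).2; simp only; linarith))
    (fun i => by
      have := (abs_le.1 (hshift u (-δ) i)).1
      rw [hu, abs_neg, abs_of_pos hδ0] at this
      linarith)
    (le_inf ((hf_mono inf_le_left).trans hu.le) ((hf_mono inf_le_right).trans fun i => by
      have h1 := (abs_le.1 (hshift w (‖u - w‖ - δ) i)).2
      rw [abs_of_nonneg (sub_nonneg.2 hδR)] at h1
      have h2 := hw i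
      simp only
      linarith))
  have hxu : x ≤ u := hx2.trans inf_le_left
  refine ⟨x, hx, lt_of_le_of_ne hxu ?_, ?_⟩
  · rintro rfl
    have h1 : ‖x - w‖ ≤ ‖x - w‖ - δ :=
      (pi_norm_le_iff_of_nonneg (sub_nonneg.2 hδR)).2 fun i => by
        have h2 : x i ≤ w i + (‖x - w‖ - δ) := (hx2.trans inf_le_right) i
        have h3 := hwu.le i
        rw [Pi.sub_apply, Real.norm_eq_abs, abs_le]
        constructor <;> linarith
    linarith
  · refine le_trans ((pi_norm_le_iff_of_nonneg hδ0.le).2 fun i => ?_) (min_le_left ε ‖u - w‖)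
    have h1 : u i + -δ ≤ x i := hx1 i
    have h2 := hxu i
    rw [Pi.sub_apply, Real.norm_eq_abs, abs_le]
    constructor <;> linarith

/-- Let `f : ℝ^d → ℝ^d` be monotone, nonexpansive (sup-norm) and
piecewise affine, `f_j(x) = min_{a ∈ A j} max_{b ∈ B a} (⟨c a b, x⟩ + r a b)`, let `u`
be a fixed point of `f`, and let `D` be the semidifferential of `f` at `u` (given by the
argmin/argmax formula). Then the following are equivalent:
(1) `u` is the smallest fixed point of `f`;
(2) the only `h ∈ ℝ^d_-` with `D h = h` is `h = 0`;
(3) `ρ_{ℝ^d_-}(D) = sup {λ ≥ 0 : ∃ h ∈ ℝ^d_- \ {0}, D h = λ h} < 1`. -/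
theorem smallest_fixed_point_characterization
    {d : ℕ} {α β : Type*}
    (A : Fin d → Set α) (B : α → Set β)
    (hAfin : ∀ j, (A j).Finite) (hAne : ∀ j, (A j).Nonempty)
    (hBfin : ∀ a, (B a).Finite) (hBne : ∀ a, (B a).Nonempty)
    (c : α → β → Fin d → ℝ) (r : α → β → ℝ)
    (f : (Fin d → ℝ) → (Fin d → ℝ))
    (hf_mono : Monotone f)
    (hf_ne : ∀ x y : Fin d → ℝ, ‖f x - f y‖ ≤ ‖x - y‖)
    (hf : ∀ x : Fin d → ℝ, ∀ j : Fin d, f x j =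
      sInf ((fun a => sSup ((fun b => (∑ i, c a b i * x i) + r a b) '' B a)) '' A j))
    (u : Fin d → ℝ)
    (hu : f u = u)
    (D : (Fin d → ℝ) → (Fin d → ℝ))
    (hD : ∀ h : Fin d → ℝ, ∀ j : Fin d, D h j =
      sInf ((fun a => sSup ((fun b => ∑ i, c a b i * h i) ''
          {b ∈ B a | (∑ i, c a b i * u i) + r a b =
            sSup ((fun b' => (∑ i, c a b' i * u i) + r a b') '' B a)})) ''
        {a ∈ A j | f u j =
          sSup ((fun b => (∑ i, c a b i * u i) + r a b) '' B a)})) :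
    ((∀ v : Fin d → ℝ, f v = v → u ≤ v) ↔
        (∀ h : Fin d → ℝ, h ≤ 0 → D h = h → h = 0)) ∧
    ((∀ h : Fin d → ℝ, h ≤ 0 → D h = h → h = 0) ↔
        sSup {l : ℝ | 0 ≤ l ∧ ∃ x : Fin d → ℝ, x ≤ 0 ∧ x ≠ 0 ∧ D x = l • x} < 1) := by
  have hlocal : ∀ᶠ h in 𝓝 (0 : Fin d → ℝ), f (u + h) = u + D h := by
    have hj : ∀ j : Fin d, ∀ᶠ h in 𝓝 (0 : Fin d → ℝ), f (u + h) j = u j + D h j := by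
      intro j
      let p : α → β → ℝ := fun a b => (∑ i, c a b i * u i) + r a b
      let q : α → β → (Fin d → ℝ) → ℝ := fun a b h => ∑ i, c a b i * h i
      have hq : ∀ a b, Tendsto (q a b) (𝓝 0) (𝓝 0) := by
        intro a b
        have hc : Continuous (q a b) := by fun_prop
        simpa [q] using hc.tendsto 0
      let P : α → ℝ := fun a => sSup (p a '' B a)
      let Q : α → (Fin d → ℝ) → ℝ := fun a h =>
        sSup ((fun b => q a b h) '' {b ∈ B a | p a b = P a})
      have hQ : ∀ a, Tendsto (Q a) (𝓝 0) (𝓝 0) := by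
        intro a
        obtain ⟨b, hb, hb'⟩ := ((hBne a).image (p a)).csSup_mem ((hBfin a).image _)
        exact tendsto_sSup_image_zero_s11 (S := {b ∈ B a | p a b = P a})
          ((hBfin a).subset fun b hb => hb.1) ⟨b, hb, hb'⟩ fun b _ => hq a b
      have hmax : ∀ᶠ h in 𝓝 (0 : Fin d → ℝ), ∀ a ∈ A j,
          sSup ((fun b => p a b + q a b h) '' B a) = P a + Q a h :=
        ((hAfin j).eventually_all).2 fun a _ =>
          eventually_sSup_image_add (hBfin a) (hBne a) (p a) fun b _ => hq a b
      filter_upwards [hmax, eventually_sInf_image_add (hAfin j) (hAne j) P fun a _ => hQ a]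
        with h h1 h2
      have hfu : sInf (P '' A j) = f u j := (hf u j).symm
      rw [← Set.image_congr h1, hfu] at h2
      have hadd : ∀ a b, (∑ i, c a b i * (u + h) i) + r a b = p a b + q a b h := by
        intro a b
        simp only [p, q, Pi.add_apply, mul_add, Finset.sum_add_distrib]
        ring
      rw [hf, hD]
      simp only [hadd]
      rw [h2, hu]
      simp only [eq_comm (a := u j)]
      rfl
    filter_upwards [eventually_all.2 hj] with h hh
    exact funext hh
  obtain ⟨ε, hε, hloc⟩ := Metric.eventually_nhds_iff.1 hlocal
  simp only [dist_zero_right] at hloc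
  have hhom : ∀ t : ℝ, 0 ≤ t → ∀ h, D (t • h) = t • D h := by
    intro t ht h
    funext j
    rw [Pi.smul_apply, hD, hD, ← Real.sInf_smul_of_nonneg ht, ← Set.image_smul, Set.image_image]
    simp only [← Real.sSup_smul_of_nonneg ht, ← Set.image_smul, Set.image_image, smul_eq_mul,
      Pi.smul_apply, Finset.mul_sum, mul_left_comm]
  have hsmall : ∀ h : Fin d → ℝ, ∃ t : ℝ, 0 < t ∧ ‖t • h‖ < ε := by
    intro h
    have hN : 0 < ‖h‖ + 1 := by positivity
    refine ⟨ε / (‖h‖ + 1), by positivity, ?_⟩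
    rw [norm_smul, Real.norm_of_nonneg (by positivity), div_mul_eq_mul_div, div_lt_iff₀ hN]
    nlinarith
  have hDne : ∀ x y, ‖D x - D y‖ ≤ ‖x - y‖ := by
    intro x y
    obtain ⟨t, ht, htm⟩ := hsmall (fun i => max |x i| |y i|)
    have hbd : ∀ z : Fin d → ℝ, (∀ i, |z i| ≤ max |x i| |y i|) → ‖t • z‖ < ε := by
      intro z hz
      refine lt_of_le_of_lt ?_ htm
      rw [norm_smul, norm_smul]
      refine mul_le_mul_of_nonneg_left ((pi_norm_le_iff_of_nonneg (norm_nonneg _)).2 fun i => ?_)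
        (norm_nonneg _)
      exact ((hz i).trans (le_abs_self _)).trans
        (norm_le_pi_norm (fun i => max |x i| |y i|) i)
    have h1 := hf_ne (u + t • x) (u + t • y)
    rw [hloc (hbd x fun i => le_max_left _ _), hloc (hbd y fun i => le_max_right _ _),
      add_sub_add_left_eq_sub, add_sub_add_left_eq_sub, hhom t ht.le, hhom t ht.le, ← smul_sub,
      ← smul_sub, norm_smul, norm_smul, Real.norm_of_nonneg ht.le] at h1
    exact le_of_mul_le_mul_left h1 ht
  have hDcont : Continuous D :=
    (LipschitzWith.of_dist_le_mul (K := 1) fun x y => by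
      simpa [dist_eq_norm] using hDne x y).continuous
  have hD0 : D 0 = 0 := by simpa using hhom 0 le_rfl 0
  have hle1 : ∀ l ∈ {l : ℝ | 0 ≤ l ∧ ∃ x : Fin d → ℝ, x ≤ 0 ∧ x ≠ 0 ∧ D x = l • x}, l ≤ 1 := by
    rintro l ⟨hl, x, -, hx, hDx⟩
    have h1 := hDne x 0
    rw [hD0, sub_zero, sub_zero, hDx, norm_smul, Real.norm_of_nonneg hl] at h1
    have h2 := norm_pos_iff.2 hx
    nlinarith
  refine ⟨⟨fun hmin h hh hDh => ?_, fun hfix v hv => ?_⟩, fun hfix => ?_, fun hlt h hh hDh => ?_⟩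
  · obtain ⟨t, ht, hth⟩ := hsmall h
    have hle := hmin (u + t • h) (by rw [hloc hth, hhom t ht.le, hDh])
    refine le_antisymm hh fun i => ?_
    have h1 := hle i
    simp only [Pi.add_apply, Pi.smul_apply, smul_eq_mul, le_add_iff_nonneg_right] at h1
    exact nonneg_of_mul_nonneg_right h1 ht
  · by_contra huv
    obtain ⟨x, hx, hxu, hxε⟩ := exists_fixed_lt_near hf_mono hf_ne hu (w := u ⊓ v)
      (le_inf ((hf_mono inf_le_left).trans hu.le) ((hf_mono inf_le_right).trans hv.le))
      (inf_lt_left.2 huv) (half_pos hε)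
    have h1 := hloc (hxε.trans_lt (half_lt_self hε))
    rw [add_sub_cancel, hx] at h1
    refine hxu.ne (sub_eq_zero.1 (hfix (x - u) (sub_nonpos.2 hxu.le) ?_))
    rw [eq_sub_iff_add_eq, add_comm]
    exact h1.symm
  · rcases Set.eq_empty_or_nonempty
      {l : ℝ | 0 ≤ l ∧ ∃ x : Fin d → ℝ, x ≤ 0 ∧ x ≠ 0 ∧ D x = l • x} with hS | hS
    · rw [hS, Real.sSup_empty]
      exact one_pos
    let K : Set (Fin d → ℝ) := Metric.sphere 0 1 ∩ Set.Iic 0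
    have hK : IsCompact K := (isCompact_sphere 0 1).inter_right isClosed_Iic
    have hnormal : ∀ x : Fin d → ℝ, x ≤ 0 → x ≠ 0 → ‖x‖⁻¹ • x ∈ K := by
      intro x hx hx0
      refine ⟨?_, smul_nonpos_of_nonneg_of_nonpos (inv_nonneg.2 (norm_nonneg x)) hx⟩
      rw [mem_sphere_zero_iff_norm, norm_smul, norm_inv, norm_norm,
        inv_mul_cancel₀ (norm_ne_zero_iff.2 hx0)]
    have hKne : K.Nonempty := by
      obtain ⟨l, -, x, hx, hx0, -⟩ := hS
      exact ⟨_, hnormal x hx hx0⟩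
    obtain ⟨y, hy, hymin⟩ := hK.exists_isMinOn hKne
      (f := fun x => ‖D x - x‖) (by fun_prop)
    have hpos : 0 < ‖D y - y‖ := by
      refine norm_pos_iff.2 (sub_ne_zero.2 fun hDy => ?_)
      have h1 := hy.1
      rw [hfix y hy.2 hDy] at h1
      simp at h1
    have hbound : sSup {l : ℝ | 0 ≤ l ∧ ∃ x : Fin d → ℝ, x ≤ 0 ∧ x ≠ 0 ∧ D x = l • x} ≤
        1 - ‖D y - y‖ := by
      refine csSup_le hS fun l hl => ?_
      have hl1 := hle1 l hl
      obtain ⟨-, x, hx, hx0, hDx⟩ := hl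
      have hxK := hnormal x hx hx0
      have h1 : ‖D y - y‖ ≤ ‖D (‖x‖⁻¹ • x) - ‖x‖⁻¹ • x‖ := hymin hxK
      have h2 : D (‖x‖⁻¹ • x) - ‖x‖⁻¹ • x = (l - 1) • (‖x‖⁻¹ • x) := by
        rw [hhom _ (inv_nonneg.2 (norm_nonneg x)), hDx, sub_smul, one_smul, smul_comm]
      rw [h2, norm_smul, mem_sphere_zero_iff_norm.1 hxK.1, mul_one, Real.norm_eq_abs,
        abs_of_nonpos (by linarith)] at h1
      linarith
    linarith
  · by_contra hne
    refine hlt.not_ge (le_csSup ⟨1, hle1⟩ ⟨zero_le_one, h, hh, hne, ?_⟩)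
    rw [one_smul, hDh]
end

section
/- Let g : ℝ^d → ℝ^d be monotone, nonexpansive with respect to the sup-norm, and suppose g has a smallest fixed point x̄ (i.e. g(x̄) = x̄ and x̄ ≤ y for every y with g(y) = y), each coordinate of g being a maximum of finitely many affine maps. Then x̄ is the unique optimal solution of the linear program min{∑_{i=1}^d x_i : x ∈ ℝ^d, g(x) ≤ x}; that is, g(x̄) ≤ x̄, for every x ∈ ℝ^d with g(x) ≤ x one has ∑_i x̄_i ≤ ∑_i x_i, and any x with g(x) ≤ x and ∑_i x_i = ∑_i x̄_i equals x̄. -/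
/-- If a monotone sup-norm nonexpansive self-map `g` of `ℝ^d` has a fixed point, then below every
`x` with `g x ≤ x` there is a fixed point, namely the limit of the iterates `g^[n] x`. -/
theorem exists_isFixedPt_le_of_map_le {ι : Type*} [Fintype ι] {g : (ι → ℝ) → (ι → ℝ)}
    (hmono : Monotone g) (hne : ∀ x y, ‖g x - g y‖ ≤ ‖x - y‖) {p x : ι → ℝ}
    (hp : Function.IsFixedPt g p) (hx : g x ≤ x) :
    ∃ y, Function.IsFixedPt g y ∧ y ≤ x := by
  have hlip : LipschitzWith 1 g := LipschitzWith.of_dist_le_mul fun x y => by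
    simpa [dist_eq_norm] using hne x y
  have hanti : Antitone fun n => g^[n] x := hmono.antitone_iterate_of_map_le hx
  have hbound : ∀ n, ‖g^[n] x - p‖ ≤ ‖x - p‖ := by
    intro n
    induction n with
    | zero => rfl
    | succ n ih =>
      rw [Function.iterate_succ_apply']
      nth_rewrite 1 [← hp.eq]
      exact (hne _ _).trans ih
  have hbdd : ∀ i, BddBelow (Set.range fun n => g^[n] x i) := by
    intro i
    refine ⟨p i - ‖x - p‖, ?_⟩
    rintro _ ⟨n, rfl⟩
    have h := (norm_le_pi_norm (g^[n] x - p) i).trans (hbound n)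
    rw [Pi.sub_apply, Real.norm_eq_abs] at h
    linarith [(abs_le.mp h).1]
  have hlim : Filter.Tendsto (fun n => g^[n] x) Filter.atTop
      (nhds fun i => ⨅ n, g^[n] x i) :=
    tendsto_pi_nhds.mpr fun i => tendsto_atTop_ciInf (fun _ _ h => hanti h i) (hbdd i)
  exact ⟨_, isFixedPt_of_tendsto_iterate hlim hlip.continuous.continuousAt,
    fun i => ciInf_le (hbdd i) 0⟩

/-- Let `g : ℝ^d → ℝ^d` be monotone and nonexpansive (sup-norm), each
coordinate of `g` being a maximum of finitely many affine maps,
`g_j(x) = max_{b ∈ B j} (⟨c j b, x⟩ + r j b)`, and suppose `g` has a smallest fixed point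
`x̄`. Then `x̄` is the unique optimal solution of the linear program
`min {∑ i, x i : g x ≤ x}`: `g x̄ ≤ x̄`, every feasible `x` (i.e. `g x ≤ x`) satisfies
`∑ i, x̄ i ≤ ∑ i, x i`, and any feasible `x` with `∑ i, x i = ∑ i, x̄ i` equals `x̄`. -/
theorem smallest_fixed_point_unique_lp_solution
    {d : ℕ} {β : Type*}
    (B : Fin d → Set β)
    (hBfin : ∀ j, (B j).Finite) (hBne : ∀ j, (B j).Nonempty)
    (c : Fin d → β → Fin d → ℝ) (r : Fin d → β → ℝ)
    (g : (Fin d → ℝ) → (Fin d → ℝ))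
    (hg_mono : Monotone g)
    (hg_ne : ∀ x y : Fin d → ℝ, ‖g x - g y‖ ≤ ‖x - y‖)
    (hg : ∀ x : Fin d → ℝ, ∀ j : Fin d, g x j =
      sSup ((fun b => (∑ i, c j b i * x i) + r j b) '' B j))
    (xbar : Fin d → ℝ)
    (hxbar_fix : g xbar = xbar)
    (hxbar_min : ∀ y : Fin d → ℝ, g y = y → xbar ≤ y) :
    g xbar ≤ xbar ∧
    (∀ x : Fin d → ℝ, g x ≤ x → ∑ i, xbar i ≤ ∑ i, x i) ∧
    (∀ x : Fin d → ℝ, g x ≤ x → ∑ i, x i = ∑ i, xbar i → x = xbar) := by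
  have hle : ∀ x : Fin d → ℝ, g x ≤ x → xbar ≤ x := fun x hx =>
    let ⟨y, hy, hyx⟩ := exists_isFixedPt_le_of_map_le hg_mono hg_ne hxbar_fix hx
    (hxbar_min y hy).trans hyx
  refine ⟨hxbar_fix.le, fun x hx => Finset.sum_le_sum fun i _ => hle x hx i,
    fun x hx hsum => ?_⟩
  funext i
  exact ((Finset.sum_eq_sum_iff_of_le fun i _ => hle x hx i).mp hsum.symm i
    (Finset.mem_univ i)).symm
end

section
/- Let g : ℝ^d → ℝ^d be monotone and nonexpansive with respect to the sup-norm, and suppose g has a fixed point. If x ∈ ℝ^d satisfies g(x) ≤ x, then the sequence (g^k(x))_{k ≥ 0} is nonincreasing and bounded below, and its limit y = lim_{k→∞} g^k(x) is a fixed point of g with y ≤ x. -/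
/-- Let `g : ℝ^d → ℝ^d` be monotone and nonexpansive (sup-norm) with a
fixed point. If `g x ≤ x`, then the sequence `(g^[k] x)ₖ` is nonincreasing and bounded
below, and its limit `y` is a fixed point of `g` with `y ≤ x`. -/
theorem iterates_of_prefixed_point_converge_to_fixed_point
    {d : ℕ} (g : (Fin d → ℝ) → (Fin d → ℝ))
    (hg_mono : Monotone g)
    (hg_ne : ∀ x y : Fin d → ℝ, ‖g x - g y‖ ≤ ‖x - y‖)
    (hfix : ∃ z : Fin d → ℝ, g z = z)
    (x : Fin d → ℝ) (hx : g x ≤ x) :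
    Antitone (fun k : ℕ => g^[k] x) ∧
    (∃ m : Fin d → ℝ, ∀ k : ℕ, m ≤ g^[k] x) ∧
    ∃ y : Fin d → ℝ,
      Filter.Tendsto (fun k : ℕ => g^[k] x) Filter.atTop (nhds y) ∧
      g y = y ∧ y ≤ x := by
  have hanti : Antitone (fun k : ℕ => g^[k] x) := hg_mono.antitone_iterate_of_map_le hx
  obtain ⟨z, hz⟩ := hfix
  have hdist (k : ℕ) : ‖g^[k] x - z‖ ≤ ‖x - z‖ := by
    induction k with
    | zero => simp
    | succ k ih =>
      rw [Function.iterate_succ_apply']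
      calc ‖g (g^[k] x) - z‖ = ‖g (g^[k] x) - g z‖ := by rw [hz]
        _ ≤ ‖g^[k] x - z‖ := hg_ne _ _
        _ ≤ ‖x - z‖ := ih
  have hbound (k : ℕ) : (fun i => z i - ‖x - z‖) ≤ g^[k] x := fun i => by
    have h : |g^[k] x i - z i| ≤ ‖x - z‖ :=
      (norm_le_pi_norm (g^[k] x - z) i).trans (hdist k)
    linarith [(abs_le.mp h).1]
  have hlim : Filter.Tendsto (fun k : ℕ => g^[k] x) Filter.atTop
      (nhds fun i => ⨅ k : ℕ, g^[k] x i) :=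
    tendsto_pi_nhds.mpr fun i =>
      tendsto_atTop_ciInf (fun _ _ hab => hanti hab i)
        ⟨z i - ‖x - z‖, by rintro _ ⟨k, rfl⟩; exact hbound k i⟩
  have hcont : Continuous g :=
    (LipschitzWith.of_dist_le_mul (K := 1) fun a b => by
      simpa [dist_eq_norm] using hg_ne a b).continuous
  exact ⟨hanti, ⟨_, hbound⟩, _, hlim,
    isFixedPt_of_tendsto_iterate hlim hcont.continuousAt, hanti.le_of_tendsto hlim 0⟩
end

section
/- Let g : ℝ^d → ℝ^d be monotone, positively homogeneous, nonexpansive with respect to the sup-norm, with g(0) = 0, and suppose g maps integer vectors to integer vectors (g(ℤ^d) ⊆ ℤ^d). Let e ∈ ℝ^d be the vector all of whose entries equal −1. Then the sequence (g^k(e))_{k ≥ 0} is nondecreasing, bounded above by 0, consists of integer vectors, and stabilizes after at most d steps: g^d(e) = g^{d+1}(e). -/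
/-- Along a monotone orbit of `{-1, 0}`-vectors, each step before stabilization
creates at least one new zero coordinate. -/
theorem iterate_eq_succ_or_le_card_zeros {ι : Type*} [Fintype ι]
    {g : (ι → ℝ) → (ι → ℝ)} {x : ι → ℝ} (hmono : Monotone fun k : ℕ => g^[k] x)
    (hval : ∀ k i, g^[k] x i = -1 ∨ g^[k] x i = 0) (k : ℕ) :
    g^[k] x = g^[k + 1] x ∨ k ≤ (Finset.univ.filter fun i => g^[k] x i = 0).card := by
  induction k with
  | zero => exact Or.inr (Nat.zero_le _)
  | succ k ih =>
    by_cases heq : g^[k] x = g^[k + 1] x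
    · left
      rw [Function.iterate_succ_apply' g (k + 1), ← heq, ← Function.iterate_succ_apply' g k, heq]
    · right
      refine Nat.succ_le_of_lt ((ih.resolve_left heq).trans_lt (Finset.card_lt_card ?_))
      have hle : ∀ i, g^[k] x i ≤ g^[k + 1] x i := hmono k.le_succ
      obtain ⟨i, hi⟩ := Function.ne_iff.mp heq
      rw [Finset.ssubset_iff_of_subset]
      · have hnew : g^[k + 1] x i = 0 ∧ g^[k] x i ≠ 0 := by
          grind [hle i, hval k i, hval (k + 1) i]
        exact ⟨i, by simpa only [Finset.mem_filter, Finset.mem_univ, true_and] using hnew⟩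
      · intro j
        simp only [Finset.mem_filter, Finset.mem_univ, true_and]
        intro hj
        rcases hval (k + 1) j with h | h
        · linarith [hle j]
        · exact h

/-- Let `g : ℝ^d → ℝ^d` be monotone, positively homogeneous,
nonexpansive (sup-norm), with `g 0 = 0`, mapping integer vectors to integer vectors.
Let `e` be the vector all of whose entries equal `-1`. Then the sequence `(g^[k] e)ₖ`
is nondecreasing, bounded above by `0`, consists of integer vectors, and stabilizes
after at most `d` steps: `g^[d] e = g^[d+1] e`. -/
theorem iterates_of_minus_one_vector_stabilize
    {d : ℕ} (g : (Fin d → ℝ) → (Fin d → ℝ))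
    (hg_mono : Monotone g)
    (hg_hom : ∀ t : ℝ, 0 < t → ∀ x : Fin d → ℝ, g (t • x) = t • g x)
    (hg_ne : ∀ x y : Fin d → ℝ, ‖g x - g y‖ ≤ ‖x - y‖)
    (hg_zero : g 0 = 0)
    (hg_int : ∀ x : Fin d → ℝ, (∀ i, ∃ n : ℤ, x i = n) → ∀ i, ∃ n : ℤ, g x i = n) :
    Monotone (fun k : ℕ => g^[k] (fun _ => (-1 : ℝ))) ∧
    (∀ k : ℕ, g^[k] (fun _ => (-1 : ℝ)) ≤ 0) ∧
    (∀ k : ℕ, ∀ i, ∃ n : ℤ, g^[k] (fun _ => (-1 : ℝ)) i = n) ∧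
    g^[d] (fun _ => (-1 : ℝ)) = g^[d + 1] (fun _ => (-1 : ℝ)) := by
  have hbase : (fun _ => (-1 : ℝ)) ≤ g (fun _ => (-1 : ℝ)) := by
    intro i
    have hnorm : ‖g (fun _ => (-1 : ℝ))‖ ≤ 1 := by
      have h := hg_ne (fun _ => (-1 : ℝ)) 0
      rw [hg_zero, sub_zero, sub_zero] at h
      exact h.trans ((pi_norm_le_iff_of_nonneg zero_le_one).mpr fun _ => by simp)
    have h := (norm_le_pi_norm (g fun _ => (-1 : ℝ)) i).trans hnorm
    exact (abs_le.mp h).1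
  have hmono := hg_mono.monotone_iterate_of_le_map hbase
  have hnonpos : ∀ k : ℕ, g^[k] (fun _ => (-1 : ℝ)) ≤ 0 := by
    intro k
    have h := hg_mono.iterate k (show (fun _ : Fin d => (-1 : ℝ)) ≤ 0 from fun _ => by simp)
    rwa [Function.iterate_fixed hg_zero] at h
  have hint : ∀ k : ℕ, ∀ i, ∃ n : ℤ, g^[k] (fun _ => (-1 : ℝ)) i = n := by
    intro k
    induction k with
    | zero => exact fun _ => ⟨-1, by simp⟩
    | succ k ih =>
      rw [Function.iterate_succ_apply']
      exact hg_int _ ih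
  have hval : ∀ k i, g^[k] (fun _ => (-1 : ℝ)) i = -1 ∨ g^[k] (fun _ => (-1 : ℝ)) i = 0 := by
    intro k i
    obtain ⟨n, hn⟩ := hint k i
    have hlow : (-1 : ℝ) ≤ n := hn ▸ hmono (Nat.zero_le k) i
    have hup : (n : ℝ) ≤ 0 := hn ▸ hnonpos k i
    rw [hn]
    norm_cast at hlow hup ⊢
    omega
  refine ⟨hmono, hnonpos, hint, ?_⟩
  rcases iterate_eq_succ_or_le_card_zeros hmono hval d with h | h
  · exact h
  · have huniv := Finset.eq_univ_of_card _
      (le_antisymm (Finset.card_le_univ _) (by rwa [Fintype.card_fin]))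
    have hzero : g^[d] (fun _ => (-1 : ℝ)) = 0 := by
      ext i
      have hi := Finset.mem_univ i
      rw [← huniv] at hi
      exact (Finset.mem_filter.mp hi).2
    rw [Function.iterate_succ_apply', hzero, hg_zero]
end

section
/- Let g : ℝ^d → ℝ^d be monotone, positively homogeneous, nonexpansive with respect to the sup-norm, with g(0) = 0, and suppose g maps integer vectors to integer vectors (g(ℤ^d) ⊆ ℤ^d). Then the spectral radius ρ_{ℝ^d_-}(g) = sup{λ ≥ 0 : ∃ x ∈ ℝ^d_- \ {0}, g(x) = λx} belongs to {0, 1}. -/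
/-- If a monotone, positively homogeneous self-map of `ℝ^d` which is norm-nonincreasing and preserves
integer vectors has a nonpositive eigenvector `x` with positive eigenvalue, then minus the indicator
vector of the support of `x` is fixed. -/
theorem map_neg_indicator_support_eq_self
    {d : ℕ} {g : (Fin d → ℝ) → (Fin d → ℝ)}
    (hg_mono : Monotone g)
    (hg_hom : ∀ t : ℝ, 0 < t → ∀ x : Fin d → ℝ, g (t • x) = t • g x)
    (hg_norm : ∀ x : Fin d → ℝ, ‖g x‖ ≤ ‖x‖)
    (hg_int : ∀ x : Fin d → ℝ, (∀ i, ∃ n : ℤ, x i = n) → ∀ i, ∃ n : ℤ, g x i = n)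
    {l : ℝ} (hl : 0 < l) {x : Fin d → ℝ} (hx : x ≤ 0) (hx0 : x ≠ 0) (hgx : g x = l • x) :
    g (fun i => if x i < 0 then -1 else 0) = fun i => if x i < 0 then -1 else 0 := by
  set z : Fin d → ℝ := fun i => if x i < 0 then -1 else 0 with hz
  have x_eq_zero : ∀ i, ¬ x i < 0 → x i = 0 := fun i hi => le_antisymm (hx i) (not_lt.1 hi)
  have hs : 0 < ‖x‖ := norm_pos_iff.2 hx0
  have upper : ‖x‖ • z ≤ x := by
    intro i
    have hi : |x i| ≤ ‖x‖ := norm_le_pi_norm x i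
    by_cases h : x i < 0
    · simpa [hz, h] using (abs_le.1 hi).1
    · simp [hz, x_eq_zero i h]
  obtain ⟨t, ht, lower⟩ : ∃ t : ℝ, 0 < t ∧ t • x ≤ z := by
    have hnn : ∀ i ∈ Finset.univ, 0 ≤ |x i|⁻¹ := fun i _ => by positivity
    refine ⟨1 + ∑ i, |x i|⁻¹, by have := Finset.sum_nonneg hnn; linarith, fun i => ?_⟩
    by_cases h : x i < 0
    · have hle := Finset.single_le_sum hnn (Finset.mem_univ i)
      have hinv : |x i|⁻¹ * x i = -1 := by
        rw [abs_of_neg h]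
        field_simp [h.ne]
      simp only [hz, h, if_true, Pi.smul_apply, smul_eq_mul]
      nlinarith
    · simp [hz, x_eq_zero i h]
  have g_upper := hg_mono upper
  have g_lower := hg_mono lower
  rw [hg_hom _ hs, hgx] at g_upper
  rw [hg_hom _ ht, hgx] at g_lower
  have z_norm : ‖z‖ ≤ 1 := (pi_norm_le_iff_of_nonneg zero_le_one).2 fun i => by
    by_cases h : x i < 0 <;> simp [hz, h]
  have z_int : ∀ i, ∃ n : ℤ, z i = n := fun i => by
    by_cases h : x i < 0
    · exact ⟨-1, by simp [hz, h]⟩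
    · exact ⟨0, by simp [hz, h]⟩
  funext i
  have hu : ‖x‖ * g z i ≤ l * x i := g_upper i
  have hlo : t * (l * x i) ≤ g z i := g_lower i
  by_cases h : x i < 0
  · have hge : -1 ≤ g z i :=
      (abs_le.1 (((norm_le_pi_norm (g z) i).trans (hg_norm z)).trans z_norm)).1
    have hneg : g z i < 0 := by
      by_contra! hc
      nlinarith [mul_pos hl (neg_pos.2 h), mul_nonneg hs.le hc]
    obtain ⟨n, hn⟩ := hg_int z z_int i
    rw [hn] at hge hneg
    have hn' : n = -1 := by
      have h₁ : -1 ≤ n := by exact_mod_cast hge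
      have h₂ : n < 0 := by exact_mod_cast hneg
      omega
    rw [hn, hn']
    simp [hz, h]
  · rw [x_eq_zero i h, mul_zero] at hu hlo
    have hle : g z i ≤ 0 := nonpos_of_mul_nonpos_right hu hs
    have hge : 0 ≤ g z i := by simpa using hlo
    rw [le_antisymm hle hge]
    simp [hz, h]

/-- Let `g : ℝ^d → ℝ^d` be monotone, positively homogeneous,
nonexpansive (sup-norm), with `g 0 = 0`, mapping integer vectors to integer vectors.
Then the spectral radius `ρ_{ℝ^d_-}(g) = sup {λ ≥ 0 : ∃ x ∈ ℝ^d_- \ {0}, g x = λ x}`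
belongs to `{0, 1}`. -/
theorem spectral_radius_zero_or_one
    {d : ℕ} (g : (Fin d → ℝ) → (Fin d → ℝ))
    (hg_mono : Monotone g)
    (hg_hom : ∀ t : ℝ, 0 < t → ∀ x : Fin d → ℝ, g (t • x) = t • g x)
    (hg_ne : ∀ x y : Fin d → ℝ, ‖g x - g y‖ ≤ ‖x - y‖)
    (hg_zero : g 0 = 0)
    (hg_int : ∀ x : Fin d → ℝ, (∀ i, ∃ n : ℤ, x i = n) → ∀ i, ∃ n : ℤ, g x i = n) :
    sSup {l : ℝ | 0 ≤ l ∧ ∃ x : Fin d → ℝ, x ≤ 0 ∧ x ≠ 0 ∧ g x = l • x} = 0 ∨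
    sSup {l : ℝ | 0 ≤ l ∧ ∃ x : Fin d → ℝ, x ≤ 0 ∧ x ≠ 0 ∧ g x = l • x} = 1 := by
  have hg_norm : ∀ x : Fin d → ℝ, ‖g x‖ ≤ ‖x‖ := fun x => by simpa [hg_zero] using hg_ne x 0
  by_cases hpos : ∃ l : ℝ, 0 < l ∧ ∃ x : Fin d → ℝ, x ≤ 0 ∧ x ≠ 0 ∧ g x = l • x
  · right
    obtain ⟨l, hl, x, hx, hx0, hgx⟩ := hpos
    refine IsGreatest.csSup_eq ⟨⟨zero_le_one, fun i => if x i < 0 then -1 else 0, ?_, ?_, ?_⟩, ?_⟩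
    · intro i
      by_cases h : x i < 0 <;> simp [h]
    · obtain ⟨i, hi⟩ := Function.ne_iff.1 hx0
      have h : x i < 0 := lt_of_le_of_ne (hx i) hi
      exact Function.ne_iff.2 ⟨i, by simp [h]⟩
    · rw [one_smul]
      exact map_neg_indicator_support_eq_self hg_mono hg_hom hg_norm hg_int hl hx hx0 hgx
    · rintro m ⟨hm, y, -, hy0, hgy⟩
      have h := hg_norm y
      rw [hgy, norm_smul, Real.norm_of_nonneg hm] at h
      exact (mul_le_iff_le_one_left (norm_pos_iff.2 hy0)).1 h
  · left
    refine le_antisymm (Real.sSup_nonpos ?_) (Real.sSup_nonneg fun l hl => hl.1)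
    rintro l ⟨-, hl⟩
    exact not_lt.1 fun h => hpos ⟨l, h, hl⟩
end

section
/- Let g : ℝ^d → ℝ^d be monotone, positively homogeneous, nonexpansive with respect to the sup-norm, with g(0) = 0, and suppose g maps integer vectors to integer vectors (g(ℤ^d) ⊆ ℤ^d). Let e ∈ ℝ^d be the vector all of whose entries equal −1. Then ρ_{ℝ^d_-}(g) = 0 if and only if g^d(e) = 0, where g^d is the d-fold iterate of g. -/
open Function in
/-- If a positively homogeneous monotone map sends some iterate of `-1` to `0`, then its
eigenvalues on the nonpositive orthant are not positive. -/
theorem eigenvalue_nonpos_of_iterate_eq_zero {ι : Type*} [Fintype ι]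
    {g : (ι → ℝ) → (ι → ℝ)} (hmono : Monotone g)
    (hhom : ∀ t : ℝ, 0 < t → ∀ x : ι → ℝ, g (t • x) = t • g x) {n : ℕ}
    (hn : g^[n] (fun _ => (-1 : ℝ)) = 0) {x : ι → ℝ} (hx : x ≤ 0) (hx0 : x ≠ 0)
    {l : ℝ} (hl : g x = l • x) : l ≤ 0 := by
  by_contra! hpos
  have hiter : ∀ t : ℝ, 0 < t → ∀ (k : ℕ) (y : ι → ℝ), g^[k] (t • y) = t • g^[k] y := by
    intro t ht k
    induction k with
    | zero => simp
    | succ k ih => intro y; rw [iterate_succ_apply, iterate_succ_apply, hhom t ht, ih]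
  have heig : ∀ k : ℕ, g^[k] x = l ^ k • x := by
    intro k
    induction k with
    | zero => simp
    | succ k ih =>
      rw [iterate_succ_apply, hl, hiter l hpos, ih, smul_smul, pow_succ']
  have hle : ‖x‖ • (fun _ => (-1 : ℝ)) ≤ x := by
    intro i
    have := (abs_le.mp (norm_le_pi_norm x i)).1
    simpa using this
  have h := hmono.iterate n hle
  rw [hiter _ (norm_pos_iff.mpr hx0), hn, smul_zero, heig] at h
  refine hx0 (le_antisymm hx fun i => ?_)
  exact nonneg_of_mul_nonneg_right (h i) (pow_pos hpos n)

/-- A strictly increasing chain of functions with values in `{-1, 0}` gains a zero at every step. -/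
theorem le_card_zeros_of_strict_chain {ι : Type*} [Fintype ι] {x : ℕ → ι → ℝ}
    (hmono : Monotone x) (hval : ∀ k i, x k i = -1 ∨ x k i = 0) {n : ℕ}
    (hne : ∀ k < n, x k ≠ x (k + 1)) : n ≤ Finset.card {i | x n i = 0} := by
  induction n with
  | zero => exact Nat.zero_le _
  | succ n ih =>
    refine Nat.succ_le_of_lt ((ih fun k hk => hne k (by omega)).trans_lt ?_)
    obtain ⟨i, hi⟩ := Function.ne_iff.mp (hne n (Nat.lt_succ_self n))
    refine Finset.card_lt_card (Finset.ssubset_iff_of_subset ?_ |>.mpr ⟨i, ?_⟩)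
    · intro j hj
      simp only [Finset.mem_filter, Finset.mem_univ, true_and] at hj ⊢
      have := hmono (Nat.le_succ n) j
      rcases hval (n + 1) j with h | h
      · simp only [Nat.succ_eq_add_one] at this; linarith
      · exact h
    · simp only [Finset.mem_filter, Finset.mem_univ, true_and]
      have := hmono (Nat.le_succ n) i
      simp only [Nat.succ_eq_add_one] at this
      rcases hval (n + 1) i with h | h
      · rcases hval n i with h' | h'
        · exact absurd (h'.trans h.symm) hi
        · linarith
      · exact ⟨h, fun h' => hi (h'.trans h.symm)⟩

open Function in
/-- The iterates of `-1` under a monotone nonexpansive map fixing `0` and preserving integer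
vectors become stationary after as many steps as there are coordinates, unless they vanish. -/
theorem iterate_minus_one_eq_zero_or_fixed {d : ℕ} {g : (Fin d → ℝ) → (Fin d → ℝ)}
    (hmono : Monotone g) (hnorm : ∀ x : Fin d → ℝ, ‖g x‖ ≤ ‖x‖) (hzero : g 0 = 0)
    (hZ : ∀ x : Fin d → ℝ, (∀ i, ∃ n : ℤ, x i = n) → ∀ i, ∃ n : ℤ, g x i = n) :
    g^[d] (fun _ => (-1 : ℝ)) = 0 ∨
      g (g^[d] fun _ => (-1 : ℝ)) = g^[d] fun _ => (-1 : ℝ) := by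
  set e : Fin d → ℝ := fun _ => -1 with he
  have hle : e ≤ g e := by
    intro i
    have h1 : ‖e‖ ≤ 1 := (pi_norm_le_iff_of_nonneg zero_le_one).mpr fun _ => by simp [he]
    exact (abs_le.mp ((norm_le_pi_norm (g e) i).trans ((hnorm e).trans h1))).1
  have hchain : Monotone fun k => g^[k] e := hmono.monotone_iterate_of_le_map hle
  have hnonpos : ∀ k, g^[k] e ≤ 0 := by
    intro k
    have h := hmono.iterate k (show e ≤ 0 from fun _ => by simp [he])
    rwa [iterate_fixed hzero] at h
  have hZiter : ∀ k i, ∃ n : ℤ, g^[k] e i = n := by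
    intro k
    induction k with
    | zero => exact fun _ => ⟨-1, by simp [he]⟩
    | succ k ih => rw [iterate_succ_apply']; exact hZ _ ih
  have hval : ∀ k i, g^[k] e i = -1 ∨ g^[k] e i = 0 := by
    intro k i
    obtain ⟨n, hn⟩ := hZiter k i
    have hlow : (-1 : ℝ) ≤ n := hn ▸ hchain (Nat.zero_le k) i
    have hupp : (n : ℝ) ≤ 0 := hn ▸ hnonpos k i
    have hlow' : -1 ≤ n := by exact_mod_cast hlow
    have hupp' : n ≤ 0 := by exact_mod_cast hupp
    obtain rfl | rfl : n = -1 ∨ n = 0 := by omega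
    · left; simpa using hn
    · right; simpa using hn
  by_cases hstat : ∃ k < d, g^[k] e = g^[k + 1] e
  · obtain ⟨k, hk, hfix⟩ := hstat
    right
    rw [iterate_succ_apply'] at hfix
    obtain ⟨m, hm⟩ := Nat.exists_eq_add_of_le' hk.le
    have hd : g^[d] e = g^[k] e := by
      conv_lhs => rw [show g^[d] = g^[m + k] from congrArg (g^[·]) hm]
      rw [iterate_add_apply, iterate_fixed hfix.symm]
    rw [hd, ← hfix]
  · push Not at hstat
    left
    have hcard := le_card_zeros_of_strict_chain hchain hval hstat
    have huniv := Finset.eq_univ_of_card (Finset.univ.filter fun i => g^[d] e i = 0)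
      (le_antisymm (Finset.card_le_univ _) (by simpa using hcard))
    ext i
    simpa using Finset.eq_univ_iff_forall.mp huniv i

/-- Let `g : ℝ^d → ℝ^d` be monotone, positively homogeneous,
nonexpansive (sup-norm), with `g 0 = 0`, mapping integer vectors to integer vectors.
Let `e` be the vector all of whose entries equal `-1`. Then
`ρ_{ℝ^d_-}(g) = sup {λ ≥ 0 : ∃ x ∈ ℝ^d_- \ {0}, g x = λ x}` equals `0` if and only if
`g^[d] e = 0`. -/
theorem spectral_radius_zero_iff_iterate_of_minus_one_vanishes
    {d : ℕ} (g : (Fin d → ℝ) → (Fin d → ℝ))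
    (hg_mono : Monotone g)
    (hg_hom : ∀ t : ℝ, 0 < t → ∀ x : Fin d → ℝ, g (t • x) = t • g x)
    (hg_ne : ∀ x y : Fin d → ℝ, ‖g x - g y‖ ≤ ‖x - y‖)
    (hg_zero : g 0 = 0)
    (hg_int : ∀ x : Fin d → ℝ, (∀ i, ∃ n : ℤ, x i = n) → ∀ i, ∃ n : ℤ, g x i = n) :
    sSup {l : ℝ | 0 ≤ l ∧ ∃ x : Fin d → ℝ, x ≤ 0 ∧ x ≠ 0 ∧ g x = l • x} = 0 ↔
      g^[d] (fun _ => (-1 : ℝ)) = 0 := by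
  have hnorm : ∀ x, ‖g x‖ ≤ ‖x‖ := fun x => by simpa [hg_zero] using hg_ne x 0
  constructor
  · intro hsup
    by_contra hne
    have hfix :=
      (iterate_minus_one_eq_zero_or_fixed hg_mono hnorm hg_zero hg_int).resolve_left hne
    have hbdd : BddAbove {l : ℝ | 0 ≤ l ∧ ∃ x : Fin d → ℝ, x ≤ 0 ∧ x ≠ 0 ∧ g x = l • x} := by
      refine ⟨1, ?_⟩
      rintro l ⟨hl0, x, -, hx0, hl⟩
      have h := hnorm x
      rw [hl, norm_smul, Real.norm_of_nonneg hl0] at h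
      exact le_of_mul_le_mul_right (by simpa using h) (norm_pos_iff.mpr hx0)
    have hnonpos : g^[d] (fun _ => (-1 : ℝ)) ≤ 0 := by
      have h := hg_mono.iterate d (show (fun _ => (-1 : ℝ)) ≤ (0 : Fin d → ℝ) from
        fun _ => by simp)
      rwa [Function.iterate_fixed hg_zero] at h
    have h1 := le_csSup hbdd ⟨zero_le_one, _, hnonpos, hne, by rw [hfix, one_smul]⟩
    linarith
  · intro hzero
    refine le_antisymm (Real.sSup_nonpos ?_) (Real.sSup_nonneg fun l hl => hl.1)
    rintro l ⟨-, x, hx, hx0, hl⟩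
    exact eigenvalue_nonpos_of_iterate_eq_zero hg_mono hg_hom hzero hx hx0 hl
end

section
/- Let g be a monotone, positively homogeneous map sending the nonpositive orthant ℝ^d_- into itself, and let x ∈ ℝ^d with x_i < 0 for all i. Then the spectral radius satisfies ρ_{ℝ^d_-}(g) ≤ max_{1 ≤ i ≤ d} g_i(x)/x_i; that is, for every λ ≥ 0 such that g(v) = λv for some nonzero v ∈ ℝ^d_-, one has λ ≤ max_i g_i(x)/x_i. -/
/-- Let `g` be a monotone, positively homogeneous map sending the
nonpositive orthant `ℝ^d_-` into itself, and let `x` have all coordinates strictly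
negative. Then the spectral radius satisfies
`ρ_{ℝ^d_-}(g) ≤ max_i g_i(x) / x_i`: every eigenvalue `λ ≥ 0` of `g` associated with a
nonzero eigenvector in `ℝ^d_-` is at most `max_i g_i(x) / x_i`, and hence so is the
supremum `ρ_{ℝ^d_-}(g)`. -/
theorem spectral_radius_le_collatz_wielandt
    {d : ℕ} (g : (Fin d → ℝ) → (Fin d → ℝ))
    (hg_map : ∀ x : Fin d → ℝ, x ≤ 0 → g x ≤ 0)
    (hg_mono : ∀ x y : Fin d → ℝ, x ≤ 0 → y ≤ 0 → x ≤ y → g x ≤ g y)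
    (hg_hom : ∀ t : ℝ, 0 < t → ∀ x : Fin d → ℝ, x ≤ 0 → g (t • x) = t • g x)
    (x : Fin d → ℝ) (hx : ∀ i, x i < 0) :
    (∀ l : ℝ, 0 ≤ l → (∃ v : Fin d → ℝ, v ≤ 0 ∧ v ≠ 0 ∧ g v = l • v) →
        l ≤ ⨆ i, g x i / x i) ∧
    sSup {l : ℝ | 0 ≤ l ∧ ∃ v : Fin d → ℝ, v ≤ 0 ∧ v ≠ 0 ∧ g v = l • v} ≤
      ⨆ i, g x i / x i := by
  have hx_nonpos : x ≤ 0 := fun i => (hx i).le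
  have eigenvalue_le : ∀ l : ℝ, 0 ≤ l → (∃ v : Fin d → ℝ, v ≤ 0 ∧ v ≠ 0 ∧ g v = l • v) →
      l ≤ ⨆ i, g x i / x i := by
    rintro l - ⟨v, hv, hv_ne, hgv⟩
    obtain ⟨k, hk⟩ := Function.ne_iff.mp hv_ne
    have : Nonempty (Fin d) := ⟨k⟩
    obtain ⟨j, hj⟩ := Finite.exists_max fun i => v i / x i
    have ht : 0 < v j / x j :=
      (div_pos_of_neg_of_neg (lt_of_le_of_ne (hv k) hk) (hx k)).trans_le (hj k)
    have hle : (v j / x j) • x ≤ v := fun i => (div_le_iff_of_neg (hx i)).mp (hj i)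
    have hg := hg_mono _ _ (smul_nonpos_of_nonneg_of_nonpos ht.le hx_nonpos) hv hle j
    rw [hg_hom _ ht x hx_nonpos, hgv, Pi.smul_apply, Pi.smul_apply, smul_eq_mul, smul_eq_mul,
      ← div_mul_cancel₀ (v j) (hx j).ne, mul_div_cancel_right₀ _ (hx j).ne,
      mul_left_comm] at hg
    exact ((le_div_iff_of_neg (hx j)).mpr (le_of_mul_le_mul_left hg ht)).trans
      (le_ciSup (f := fun i => g x i / x i) (Set.finite_range _).bddAbove j)
  exact ⟨eigenvalue_le, Real.sSup_le (fun l hl => eigenvalue_le l hl.1 hl.2)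
    (Real.iSup_nonneg fun i => div_nonneg_of_nonpos (hg_map x hx_nonpos i) (hx_nonpos i))⟩
end
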